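/- arXiv:math/0304346 — 2 statements merged into one kernel-verified Lean document; each statement's English description precedes it below -/
import Mathlib

section
/- Let ℓ be a line in Euclidean 3-space and let S₁, S₂, S₃ be pairwise distinct spheres with centres c₁, c₂, c₃ and radii r₁, r₂, r₃ > 0. The set of lines that meet ℓ and are tangent to all three spheres is infinite if and only if at least one of the following holds: (i) there exist a point p and a plane Π with p ∈ Π such that Sᵢ ∩ Π = {p} for i = 1,2,3, and moreover p ∈ ℓ or ℓ ⊆ Π; (ii) there exist a point p ∈ ℓ, a unit vector v, a constant k ∈ (0,1) and nonzero reals t₁, t₂, t₃ such that cᵢ = p + tᵢ • v and rᵢ = k·|tᵢ| for i = 1,2,3 (the spheres are inscribed in a cone with apex p on ℓ); (iii) there exist a plane Π with ℓ ⊆ Π, a point o ∈ Π and ρ > 0 such that the circle Π ∩ S(o,ρ) is contained in Sᵢ for i = 1,2,3 (the spheres meet in a common circle whose plane contains ℓ); (iv) there is a line m containing c₁, c₂, c₃ whose direction is different from the direction of ℓ, and ℓ is tangent to each of S₁, S₂, S₃. -/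
noncomputable section

/-- Euclidean 3-space. -/
abbrev E3 : Type := EuclideanSpace ℝ (Fin 3)

/-- A line in `ℝ³`: a 1-dimensional affine subspace. -/
def IsLine (L : AffineSubspace ℝ E3) : Prop := Module.finrank ℝ L.direction = 1

/-- A plane in `ℝ³`: a 2-dimensional affine subspace. -/
def IsPlane (P : AffineSubspace ℝ E3) : Prop := Module.finrank ℝ P.direction = 2

/-- A line is tangent to the sphere with centre `c` and radius `r` if the distance
from `c` to the line equals `r`. -/
def Tangent (c : E3) (r : ℝ) (L : AffineSubspace ℝ E3) : Prop :=
  Metric.infDist c (L : Set E3) = r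

/-- A line `L` meets a line `ℓ` if they have a common point. -/
def Meets (L ℓ : AffineSubspace ℝ E3) : Prop :=
  ((L : Set E3) ∩ (ℓ : Set E3)).Nonempty

section SquareRoots

open Polynomial Matrix

theorem isSquare_of_mul_sq_eq_sq {n P R : ℝ[X]} (hP : P ≠ 0) (h : n * P ^ 2 = R ^ 2) :
    IsSquare n := by
  have hd : P ∣ R :=
    (UniqueFactorizationMonoid.pow_dvd_pow_iff_dvd two_ne_zero).1 ⟨n, by rw [← h]; ring⟩
  obtain ⟨Q, rfl⟩ := hd
  refine ⟨Q, ?_⟩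
  have : n * P ^ 2 = (Q * Q) * P ^ 2 := by rw [h]; ring
  exact mul_right_cancel₀ (pow_ne_zero 2 hP) this

variable {K : Type*} [Field K] {φ : ℝ[X] →+* K}

theorem eq_zero_of_add_mul_sqrt_eq_zero (hφ : Function.Injective φ) {n A B : ℝ[X]} {s : K}
    (hn : ¬ IsSquare n) (hs : s ^ 2 = φ n) (h : φ A + φ B * s = 0) : A = 0 ∧ B = 0 := by
  have hB : B = 0 := by
    by_contra hB
    refine hn (isSquare_of_mul_sq_eq_sq (R := A) hB (hφ ?_))
    simp only [map_mul, map_pow]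
    linear_combination (-φ B ^ 2) * hs + (φ B * s - φ A) * h
  subst hB
  refine ⟨hφ ?_, rfl⟩
  simpa using h

theorem add_mul_sqrt_mul_sqrt_eq_zero (hφ : Function.Injective φ)
    {f₁ f₂ f₃ P₀ P₁ P₂ P₃ : ℝ[X]} {s₁ s₂ s₃ : K} (hf₁ : f₁ ≠ 0)
    (h₁₃ : ¬ IsSquare (f₁ * f₃)) (h₂₃ : ¬ IsSquare (f₂ * f₃))
    (hs₁ : s₁ ^ 2 = φ f₁) (hs₂ : s₂ ^ 2 = φ f₂) (hs₃ : s₃ ^ 2 = φ f₃)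
    (h : φ P₀ + φ P₁ * (s₂ * s₃) + φ P₂ * (s₁ * s₃) + φ P₃ * (s₁ * s₂) = 0) :
    φ P₀ + φ P₃ * (s₁ * s₂) = 0 := by
  have hf₁' : φ f₁ ≠ 0 := by simpa using hφ.ne hf₁
  have hs₁' : s₁ ≠ 0 := by rintro rfl; apply hf₁'; rw [← hs₁]; ring
  have hs₁₃ : (s₁ * s₃) ^ 2 = φ (f₁ * f₃) := by rw [map_mul, ← hs₁, ← hs₃]; ring
  have hs₁₂ : (s₁ * s₂) ^ 2 = φ (f₁ * f₂) := by rw [map_mul, ← hs₁, ← hs₂]; ring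
  by_cases hm : IsSquare (f₁ * f₂)
  · obtain ⟨h₀, hh₀⟩ := hm
    obtain ⟨g, hg⟩ : ∃ g : ℝ[X], s₁ * s₂ = φ g := by
      have : (s₁ * s₂) ^ 2 = φ h₀ ^ 2 := by rw [hs₁₂, hh₀, map_mul, sq]
      rcases sq_eq_sq_iff_eq_or_eq_neg.1 this with h' | h'
      · exact ⟨h₀, h'⟩
      · exact ⟨-h₀, by simpa using h'⟩
    have key : φ (f₁ * (P₀ + P₃ * g)) + φ (P₁ * g + P₂ * f₁) * (s₁ * s₃) = 0 := by
      simp only [map_mul, map_add, ← hg, ← hs₁]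
      linear_combination s₁ ^ 2 * h
    have := (eq_zero_of_add_mul_sqrt_eq_zero hφ h₁₃ hs₁₃ key).1
    have h0 : P₀ + P₃ * g = 0 := (mul_eq_zero.1 this).resolve_left hf₁
    rw [hg, ← map_mul, ← map_add, h0, map_zero]
  · set A := f₁ * P₀
    set B := f₁ * P₃
    set D := P₁
    set C := f₁ * P₂
    have key : φ A + φ B * (s₁ * s₂) + (φ C + φ D * (s₁ * s₂)) * (s₁ * s₃) = 0 := by
      simp only [A, B, C, D, map_mul, ← hs₁]
      linear_combination s₁ ^ 2 * h
    set m := f₁ * f₂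
    set n := f₁ * f₃
    set R := A * C - B * D * m
    set S := B * C - A * D
    set Q := C ^ 2 - D ^ 2 * m
    have key2 : φ R + φ S * (s₁ * s₂) + φ Q * (s₁ * s₃) = 0 := by
      simp only [R, S, Q, map_sub, map_mul, map_pow, ← hs₁₂]
      linear_combination (φ C - φ D * (s₁ * s₂)) * key
    have key3 : φ (R ^ 2 + S ^ 2 * m - Q ^ 2 * n) + φ (2 * R * S) * (s₁ * s₂) = 0 := by
      simp only [map_sub, map_mul, map_pow, map_add, map_ofNat, ← hs₁₂, ← hs₁₃]
      linear_combination (φ R + φ S * (s₁ * s₂) - φ Q * (s₁ * s₃)) * key2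
    obtain ⟨e1, e2⟩ := eq_zero_of_add_mul_sqrt_eq_zero hφ hm hs₁₂ key3
    have hQ : Q = 0 := by
      by_contra hQ
      have : R = 0 ∨ S = 0 := by simpa using e2
      rcases this with h0 | h0
      · rw [h0] at e1
        refine h₂₃ (isSquare_of_mul_sq_eq_sq (P := Q * f₁) (R := S * m) (mul_ne_zero hQ hf₁) ?_)
        simp only [m, n] at e1 ⊢
        linear_combination -(f₁ * f₂) * e1
      · rw [h0] at e1
        exact h₁₃ (isSquare_of_mul_sq_eq_sq (P := Q) (R := R) hQ (by linear_combination -e1))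
    have hD : D = 0 := by
      by_contra hD
      exact hm (isSquare_of_mul_sq_eq_sq (P := D) (R := C) hD (by linear_combination -hQ))
    have hC : C = 0 := by
      have : C ^ 2 = 0 := by linear_combination hQ + D * m * hD
      exact pow_eq_zero_iff two_ne_zero |>.1 this
    rw [hC, hD] at key
    have : φ f₁ * (φ P₀ + φ P₃ * (s₁ * s₂)) = 0 := by
      simp only [A, B, map_mul, map_zero] at key
      linear_combination key
    exact (mul_eq_zero.1 this).resolve_left hf₁'

theorem coeff_eq_zero_of_sqrt_relation (hφ : Function.Injective φ)
    {f₁ f₂ f₃ P₁ P₂ P₃ : ℝ[X]} {s₁ s₂ s₃ : K} (hf₁ : f₁ ≠ 0) (hf₃ : f₃ ≠ 0)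
    (h₁₃ : ¬ IsSquare (f₁ * f₃)) (h₂₃ : ¬ IsSquare (f₂ * f₃))
    (hs₁ : s₁ ^ 2 = φ f₁) (hs₂ : s₂ ^ 2 = φ f₂) (hs₃ : s₃ ^ 2 = φ f₃)
    (h : φ P₁ * s₁ + φ P₂ * s₂ + φ P₃ * s₃ = 0) : P₃ = 0 := by
  have := add_mul_sqrt_mul_sqrt_eq_zero (P₀ := f₃ * P₃) (P₁ := P₂) (P₂ := P₁) (P₃ := 0) hφ hf₁
    h₁₃ h₂₃ hs₁ hs₂ hs₃ (by
      simp only [map_mul, map_zero, ← hs₃]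
      linear_combination s₃ * h)
  rw [map_zero, zero_mul, add_zero] at this
  exact (mul_eq_zero.1 ((map_eq_zero_iff φ hφ).1 this)).resolve_left hf₃

/-- The monic quadratic polynomial with vertex `(a, g)`. -/
def monicQuadratic (a g : ℝ) : ℝ[X] := (X - C a) ^ 2 + C g

@[simp] theorem eval_monicQuadratic (a g t : ℝ) :
    (monicQuadratic a g).eval t = (t - a) ^ 2 + g := by
  simp [monicQuadratic]

theorem monicQuadratic_ne_zero (a g : ℝ) : monicQuadratic a g ≠ 0 := by
  intro h
  have h0 := congrArg (eval a) h
  have h1 := congrArg (eval (a + 1)) h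
  simp at h0 h1
  linarith

theorem eq_or_eq_zero_of_isSquare_mul {a g a' g' : ℝ}
    (h : IsSquare (monicQuadratic a g * monicQuadratic a' g')) :
    (a = a' ∧ g = g') ∨ (g = 0 ∧ g' = 0) := by
  obtain ⟨Q, hQ⟩ := h
  have hdeg (a g : ℝ) : (monicQuadratic a g).natDegree = 2 := by
    unfold monicQuadratic; compute_degree!
  have hQ2 : Q.natDegree = 2 := by
    have := congrArg natDegree hQ
    rw [natDegree_mul (monicQuadratic_ne_zero _ _) (monicQuadratic_ne_zero _ _), hdeg, hdeg,
      ← sq, natDegree_pow] at this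
    omega
  have hev (t : ℝ) : ((t - a) ^ 2 + g) * ((t - a') ^ 2 + g') =
      (Q.coeff 0 + Q.coeff 1 * t + Q.coeff 2 * t ^ 2) ^ 2 := by
    have := congrArg (eval t) hQ
    rw [eval_mul, eval_mul, eval_monicQuadratic, eval_monicQuadratic,
      eval_eq_sum_range, hQ2] at this
    rw [this]
    simp [Finset.sum_range_succ]
    ring
  generalize Q.coeff 0 = q at hev
  generalize Q.coeff 1 = p at hev
  generalize Q.coeff 2 = l at hev
  have e0 := hev 0
  have e1 := hev 1
  have e2 := hev (-1)
  have e3 := hev 2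
  have e4 := hev (-2)
  have hl : l ^ 2 = 1 := by linear_combination (-1/4)*e0 + (1/6)*(e1+e2) - (1/24)*(e3+e4)
  have hc3 : l * p = -(a + a') := by
    linear_combination (-1/24)*e3+(1/24)*e4 + (1/12)*e1 - (1/12)*e2
  have hc2 : p ^ 2 + 2 * l * q = a ^ 2 + g + a' ^ 2 + g' + 4 * a * a' := by
    linear_combination (1/24)*(e3+e4) - (2/3)*(e1+e2) + (5/4)*e0
  have hc1 : 2 * p * q = -2 * a * (a' ^ 2 + g') - 2 * a' * (a ^ 2 + g) := by
    linear_combination (1/12)*e3 - (1/12)*e4 - (2/3)*e1 + (2/3)*e2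
  have hc0 : q ^ 2 = (a ^ 2 + g) * (a' ^ 2 + g') := by linear_combination -e0
  have hp : p = -l * (a + a') := by linear_combination l * hc3 - p * hl
  obtain ⟨q', rfl⟩ : ∃ q', q = l * q' := ⟨l * q, by linear_combination -q * hl⟩
  subst hp
  have hc2' : 2 * q' = 2 * a * a' + g + g' := by
    linear_combination hc2 - ((a + a') ^ 2 + 2 * q') * hl
  have hc1' : (a + a') * q' = a * (a' ^ 2 + g') + a' * (a ^ 2 + g) := by
    linear_combination (-1/2) * hc1 - (a + a') * q' * hl
  have hc0' : q' ^ 2 = (a ^ 2 + g) * (a' ^ 2 + g') := by linear_combination hc0 - q' ^ 2 * hl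
  have h1 : (a - a') * (g - g') = 0 := by linear_combination 2 * hc1' - (a + a') * hc2'
  rcases mul_eq_zero.1 h1 with h | h
  · left
    obtain rfl : a = a' := by linarith
    refine ⟨rfl, ?_⟩
    have : (g - g') ^ 2 = 0 := by
      linear_combination 4 * hc0' - (2 * q' + 2 * a * a + g + g') * hc2'
    have := pow_eq_zero_iff two_ne_zero |>.1 this
    linarith
  · obtain rfl : g = g' := by linarith
    have h2 : (a - a') ^ 2 * g = 0 := by
      linear_combination -hc0' + (1/4) * (2 * q' + 2 * a * a' + 2 * g) * hc2'
    rcases mul_eq_zero.1 h2 with h | h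
    · left
      exact ⟨by linarith [pow_eq_zero_iff two_ne_zero |>.1 h], rfl⟩
    · exact Or.inr ⟨h, h⟩

theorem monicQuadratic_classes (a₁ a₂ a₃ g₁ g₂ g₃ : ℝ) :
    (a₁ = a₃ ∧ a₂ = a₃ ∧ g₁ = g₃ ∧ g₂ = g₃) ∨ (g₁ = 0 ∧ g₂ = 0 ∧ g₃ = 0) ∨
    (¬ IsSquare (monicQuadratic a₁ g₁ * monicQuadratic a₃ g₃) ∧
      ¬ IsSquare (monicQuadratic a₂ g₂ * monicQuadratic a₃ g₃)) ∨
    (¬ IsSquare (monicQuadratic a₂ g₂ * monicQuadratic a₁ g₁) ∧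
      ¬ IsSquare (monicQuadratic a₃ g₃ * monicQuadratic a₁ g₁)) ∨
    (¬ IsSquare (monicQuadratic a₃ g₃ * monicQuadratic a₂ g₂) ∧
      ¬ IsSquare (monicQuadratic a₁ g₁ * monicQuadratic a₂ g₂)) := by
  have h₁₂ := @eq_or_eq_zero_of_isSquare_mul a₁ g₁ a₂ g₂
  have h₂₃ := @eq_or_eq_zero_of_isSquare_mul a₂ g₂ a₃ g₃
  have h₁₃ := @eq_or_eq_zero_of_isSquare_mul a₁ g₁ a₃ g₃
  rw [mul_comm (monicQuadratic a₂ g₂) (monicQuadratic a₁ g₁),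
    mul_comm (monicQuadratic a₃ g₃) (monicQuadratic a₁ g₁),
    mul_comm (monicQuadratic a₃ g₃) (monicQuadratic a₂ g₂)]
  grind

end SquareRoots

section NonCoplanar

open Polynomial Matrix Filter

theorem dotProduct_sq_le (u v : Fin 3 → ℝ) : (u ⬝ᵥ v) ^ 2 ≤ (u ⬝ᵥ u) * (v ⬝ᵥ v) := by
  simp only [dotProduct, Fin.sum_univ_three]
  nlinarith [sq_nonneg (u 0 * v 1 - u 1 * v 0), sq_nonneg (u 0 * v 2 - u 2 * v 0),
    sq_nonneg (u 1 * v 2 - u 2 * v 1)]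

/-- The solution of the linear system `wᵢ ⬝ᵥ u = sᵢ det(w₁, w₂, w₃)`. -/
def cramerVec {R : Type*} [CommRing R] (w₁ w₂ w₃ : Fin 3 → R) (s₁ s₂ s₃ : R) : Fin 3 → R :=
  s₁ • w₂ ⨯₃ w₃ + s₂ • w₃ ⨯₃ w₁ + s₃ • w₁ ⨯₃ w₂

section CommRing

variable {R : Type*} [CommRing R] (w₁ w₂ w₃ : Fin 3 → R)

theorem dotProduct_cramerVec_fst (s₁ s₂ s₃ : R) :
    w₁ ⬝ᵥ cramerVec w₁ w₂ w₃ s₁ s₂ s₃ = s₁ * w₁ ⬝ᵥ w₂ ⨯₃ w₃ := by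
  simp [cramerVec, dotProduct_add, dotProduct_smul]

theorem dotProduct_cramerVec_snd (s₁ s₂ s₃ : R) :
    w₂ ⬝ᵥ cramerVec w₁ w₂ w₃ s₁ s₂ s₃ = s₂ * w₁ ⬝ᵥ w₂ ⨯₃ w₃ := by
  simp [cramerVec, dotProduct_add, dotProduct_smul, triple_product_permutation w₁ w₂ w₃]

theorem dotProduct_cramerVec_thd (s₁ s₂ s₃ : R) :
    w₃ ⬝ᵥ cramerVec w₁ w₂ w₃ s₁ s₂ s₃ = s₃ * w₁ ⬝ᵥ w₂ ⨯₃ w₃ := by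
  simp [cramerVec, dotProduct_add, dotProduct_smul, ← triple_product_permutation w₃ w₁ w₂]

theorem cramerVec_dotProduct (v : Fin 3 → R) :
    cramerVec w₁ w₂ w₃ (w₁ ⬝ᵥ v) (w₂ ⬝ᵥ v) (w₃ ⬝ᵥ v) = (w₁ ⬝ᵥ w₂ ⨯₃ w₃) • v := by
  ext i
  fin_cases i <;> simp [cramerVec, cross_apply, dotProduct, Fin.sum_univ_three] <;> ring

theorem map_cross {S : Type*} [CommRing S] (φ : R →+* S) (u v : Fin 3 → R) :
    φ ∘ (u ⨯₃ v) = (φ ∘ u) ⨯₃ (φ ∘ v) := by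
  ext i
  fin_cases i <;> simp [cross_apply]

theorem map_cramerVec {S : Type*} [CommRing S] (φ : R →+* S) (s₁ s₂ s₃ : R) :
    φ ∘ (cramerVec w₁ w₂ w₃ s₁ s₂ s₃) =
      cramerVec (φ ∘ w₁) (φ ∘ w₂) (φ ∘ w₃) (φ s₁) (φ s₂) (φ s₃) := by
  simp only [cramerVec, ← map_cross]
  ext i
  simp

theorem cramerVec_dotProduct_self (s₁ s₂ s₃ : R) :
    cramerVec w₁ w₂ w₃ s₁ s₂ s₃ ⬝ᵥ cramerVec w₁ w₂ w₃ s₁ s₂ s₃ =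
      s₁ ^ 2 * (w₂ ⨯₃ w₃ ⬝ᵥ w₂ ⨯₃ w₃) + s₂ ^ 2 * (w₃ ⨯₃ w₁ ⬝ᵥ w₃ ⨯₃ w₁) +
      s₃ ^ 2 * (w₁ ⨯₃ w₂ ⬝ᵥ w₁ ⨯₃ w₂) + 2 * (s₁ * s₂) * (w₂ ⨯₃ w₃ ⬝ᵥ w₃ ⨯₃ w₁) +
      2 * (s₁ * s₃) * (w₂ ⨯₃ w₃ ⬝ᵥ w₁ ⨯₃ w₂) + 2 * (s₂ * s₃) * (w₃ ⨯₃ w₁ ⬝ᵥ w₁ ⨯₃ w₂) := by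
  simp only [cramerVec, dotProduct_add, add_dotProduct, smul_dotProduct, dotProduct_smul,
    smul_eq_mul]
  rw [dotProduct_comm (w₃ ⨯₃ w₁) (w₂ ⨯₃ w₃), dotProduct_comm (w₁ ⨯₃ w₂) (w₂ ⨯₃ w₃),
    dotProduct_comm (w₁ ⨯₃ w₂) (w₃ ⨯₃ w₁)]
  ring

end CommRing

theorem sq_sub_le_of_cramerVec {w₁ w₂ w₃ : Fin 3 → ℝ} {s₁ s₂ s₃ : ℝ}
    (hD : w₁ ⬝ᵥ w₂ ⨯₃ w₃ ≠ 0)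
    (h : cramerVec w₁ w₂ w₃ s₁ s₂ s₃ ⬝ᵥ cramerVec w₁ w₂ w₃ s₁ s₂ s₃ = (w₁ ⬝ᵥ w₂ ⨯₃ w₃) ^ 2) :
    (s₁ - s₂) ^ 2 ≤ (w₁ - w₂) ⬝ᵥ (w₁ - w₂) ∧ (s₂ - s₃) ^ 2 ≤ (w₂ - w₃) ⬝ᵥ (w₂ - w₃) := by
  have hD' := sq_pos_of_ne_zero hD
  have h1 := dotProduct_sq_le (w₁ - w₂) (cramerVec w₁ w₂ w₃ s₁ s₂ s₃)
  have h2 := dotProduct_sq_le (w₂ - w₃) (cramerVec w₁ w₂ w₃ s₁ s₂ s₃)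
  rw [h, sub_dotProduct, dotProduct_cramerVec_snd] at h1 h2
  rw [dotProduct_cramerVec_fst] at h1
  rw [dotProduct_cramerVec_thd] at h2
  rw [← sub_mul, mul_pow] at h1 h2
  exact ⟨le_of_mul_le_mul_right h1 hD', le_of_mul_le_mul_right h2 hD'⟩

theorem false_of_cramer_relation {w₁ w₂ w₃ : Fin 3 → ℝ} {f₁ f₂ f₃ r₁ r₃ η : ℝ}
    (hD : w₁ ⬝ᵥ w₂ ⨯₃ w₃ ≠ 0) (h₁ : w₁ ⬝ᵥ w₁ = f₁ + r₁ ^ 2) (h₃ : w₃ ⬝ᵥ w₃ = f₃ + r₃ ^ 2)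
    (hf₁ : r₁ ^ 2 < f₁) (hf₃ : r₃ ^ 2 < f₃) (hη : η ^ 2 = f₁ * f₂)
    (h : f₁ * (w₂ ⨯₃ w₃ ⬝ᵥ w₂ ⨯₃ w₃) + f₂ * (w₃ ⨯₃ w₁ ⬝ᵥ w₃ ⨯₃ w₁) +
      f₃ * (w₁ ⨯₃ w₂ ⬝ᵥ w₁ ⨯₃ w₂) + 2 * η * (w₂ ⨯₃ w₃ ⬝ᵥ w₃ ⨯₃ w₁) =
      (w₁ ⬝ᵥ w₂ ⨯₃ w₃) ^ 2) : False := by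
  have hD' := sq_pos_of_ne_zero hD
  have i1 := dotProduct_sq_le w₁ (cramerVec w₁ w₂ w₃ f₁ η 0)
  rw [dotProduct_cramerVec_fst, cramerVec_dotProduct_self, h₁] at i1
  have i3 := dotProduct_sq_le w₃ (cramerVec w₁ w₂ w₃ 0 0 1)
  rw [dotProduct_cramerVec_thd, cramerVec_dotProduct_self, h₃] at i3
  generalize w₁ ⬝ᵥ w₂ ⨯₃ w₃ = D at *
  generalize w₂ ⨯₃ w₃ ⬝ᵥ w₂ ⨯₃ w₃ = A₁₁ at *
  generalize w₃ ⨯₃ w₁ ⬝ᵥ w₃ ⨯₃ w₁ = A₂₂ at *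
  generalize w₁ ⨯₃ w₂ ⬝ᵥ w₁ ⨯₃ w₂ = A₃₃ at *
  generalize w₂ ⨯₃ w₃ ⬝ᵥ w₃ ⨯₃ w₁ = A₁₂ at *
  have p1 : 0 < f₁ := by nlinarith [sq_nonneg r₁]
  have p3 : 0 < f₃ := by nlinarith [sq_nonneg r₃]
  set Y := f₁ * A₁₁ + f₂ * A₂₂ + 2 * η * A₁₂ with hY
  have i1' : f₁ * D ^ 2 ≤ (f₁ + r₁ ^ 2) * Y := by
    refine le_of_mul_le_mul_left ?_ p1
    linear_combination i1 + (f₁ + r₁ ^ 2) * A₂₂ * hη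
  have i3' : D ^ 2 ≤ (f₃ + r₃ ^ 2) * A₃₃ := by linear_combination i3
  have hYA : Y + f₃ * A₃₃ = D ^ 2 := by linear_combination h
  have hYpos : D ^ 2 < 2 * Y := by
    by_contra hc
    nlinarith [sq_nonneg r₁]
  have hApos : D ^ 2 < 2 * (f₃ * A₃₃) := by
    have hA : 0 < A₃₃ := by
      by_contra hc
      nlinarith [sq_nonneg r₃]
    nlinarith
  linarith

/-- The vector from the point `(t, 0, 0)` to the point `(a, b, c)`, with `t` an indeterminate. -/
def centerVec (a b c : ℝ) : Fin 3 → ℝ[X] := ![C a - X, C b, C c]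

theorem eval_comp_centerVec (a b c t : ℝ) :
    evalRingHom t ∘ centerVec a b c = ![a - t, b, c] := by
  ext i
  fin_cases i <;> simp [centerVec]

theorem eventually_lt_sq_sub_add (a g M : ℝ) : ∀ᶠ t in atTop, M < (t - a) ^ 2 + g := by
  filter_upwards [eventually_gt_atTop (a + 1 + |M - g|)] with t ht
  nlinarith [le_abs_self (M - g), abs_nonneg (M - g)]

variable {K : Type*} [Field K] {φ : ℝ[X] →+* K}

theorem cramerVec_map_eq {w₁ w₂ w₃ : Fin 3 → K} {v : Fin 3 → K} (hv : v ⬝ᵥ v = 1) :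
    cramerVec w₁ w₂ w₃ (w₁ ⬝ᵥ v) (w₂ ⬝ᵥ v) (w₃ ⬝ᵥ v) ⬝ᵥ
      cramerVec w₁ w₂ w₃ (w₁ ⬝ᵥ v) (w₂ ⬝ᵥ v) (w₃ ⬝ᵥ v) = (w₁ ⬝ᵥ w₂ ⨯₃ w₃) ^ 2 := by
  rw [cramerVec_dotProduct, smul_dotProduct, dotProduct_smul, hv]
  simp [sq]

theorem false_of_isolated_class (hφ : Function.Injective φ)
    {a₁ b₁ c₁ g₁ a₂ b₂ c₂ g₂ a₃ b₃ c₃ g₃ r₁ r₃ : ℝ} {v : Fin 3 → K} (hv : v ⬝ᵥ v = 1)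
    (hD : centerVec a₁ b₁ c₁ ⬝ᵥ centerVec a₂ b₂ c₂ ⨯₃ centerVec a₃ b₃ c₃ ≠ 0)
    (h₁₃ : ¬ IsSquare (monicQuadratic a₁ g₁ * monicQuadratic a₃ g₃))
    (h₂₃ : ¬ IsSquare (monicQuadratic a₂ g₂ * monicQuadratic a₃ g₃))
    (hg₁ : b₁ ^ 2 + c₁ ^ 2 = g₁ + r₁ ^ 2) (hg₃ : b₃ ^ 2 + c₃ ^ 2 = g₃ + r₃ ^ 2)
    (hs₁ : ((φ ∘ centerVec a₁ b₁ c₁) ⬝ᵥ v) ^ 2 = φ (monicQuadratic a₁ g₁))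
    (hs₂ : ((φ ∘ centerVec a₂ b₂ c₂) ⬝ᵥ v) ^ 2 = φ (monicQuadratic a₂ g₂))
    (hs₃ : ((φ ∘ centerVec a₃ b₃ c₃) ⬝ᵥ v) ^ 2 = φ (monicQuadratic a₃ g₃)) : False := by
  have hE := cramerVec_map_eq (w₁ := φ ∘ centerVec a₁ b₁ c₁) (w₂ := φ ∘ centerVec a₂ b₂ c₂)
    (w₃ := φ ∘ centerVec a₃ b₃ c₃) hv
  rw [cramerVec_dotProduct_self, hs₁, hs₂, hs₃] at hE
  simp only [← map_cross, ← RingHom.map_dotProduct] at hE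
  have hw₁ (t : ℝ) := eval_comp_centerVec a₁ b₁ c₁ t
  have hw₂ (t : ℝ) := eval_comp_centerVec a₂ b₂ c₂ t
  have hw₃ (t : ℝ) := eval_comp_centerVec a₃ b₃ c₃ t
  have hEv (t : ℝ) (P : ℝ[X]) : eval t P = evalRingHom t P := rfl
  generalize centerVec a₁ b₁ c₁ = w₁ at *
  generalize centerVec a₂ b₂ c₂ = w₂ at *
  generalize centerVec a₃ b₃ c₃ = w₃ at *
  set f₁ := monicQuadratic a₁ g₁ with hf₁
  set f₂ := monicQuadratic a₂ g₂ with hf₂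
  set f₃ := monicQuadratic a₃ g₃ with hf₃
  set s₁ := (φ ∘ w₁) ⬝ᵥ v
  set s₂ := (φ ∘ w₂) ⬝ᵥ v
  set s₃ := (φ ∘ w₃) ⬝ᵥ v
  set P₀ : ℝ[X] := f₁ * (w₂ ⨯₃ w₃ ⬝ᵥ w₂ ⨯₃ w₃) + f₂ * (w₃ ⨯₃ w₁ ⬝ᵥ w₃ ⨯₃ w₁) +
      f₃ * (w₁ ⨯₃ w₂ ⬝ᵥ w₁ ⨯₃ w₂) - (w₁ ⬝ᵥ w₂ ⨯₃ w₃) ^ 2 with hP₀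
  set P₃ : ℝ[X] := 2 * (w₂ ⨯₃ w₃ ⬝ᵥ w₃ ⨯₃ w₁) with hP₃
  have hα := add_mul_sqrt_mul_sqrt_eq_zero (P₀ := P₀) (P₃ := P₃)
    (P₂ := 2 * (w₂ ⨯₃ w₃ ⬝ᵥ w₁ ⨯₃ w₂)) (P₁ := 2 * (w₃ ⨯₃ w₁ ⬝ᵥ w₁ ⨯₃ w₂)) hφ
    (monicQuadratic_ne_zero a₁ g₁) h₁₃ h₂₃ hs₁ hs₂ hs₃ (by
      simp only [hP₀, hP₃, map_sub, map_add, map_mul, map_pow, map_ofNat]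
      linear_combination hE)
  obtain ⟨t, ht₀, ht₁, ht₂, ht₃⟩ := ((eventually_atTop_not_isRoot _ hD).and
    ((eventually_lt_sq_sub_add a₁ g₁ (r₁ ^ 2)).and ((eventually_lt_sq_sub_add a₂ g₂ 0).and
      (eventually_lt_sq_sub_add a₃ g₃ (r₃ ^ 2))))).exists
  have hη : ∃ η : ℝ, η ^ 2 = f₁.eval t * f₂.eval t ∧ P₀.eval t + P₃.eval t * η = 0 := by
    by_cases hm : IsSquare (f₁ * f₂)
    · obtain ⟨h₀, hh⟩ := hm
      have hsq : (s₁ * s₂) ^ 2 = φ h₀ ^ 2 := by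
        rw [mul_pow, hs₁, hs₂, ← map_mul, hh, map_mul, sq]
      have hh' := congrArg (eval t) hh
      rw [eval_mul, eval_mul] at hh'
      rcases sq_eq_sq_iff_eq_or_eq_neg.1 hsq with h | h
      · rw [h, ← map_mul, ← map_add, map_eq_zero_iff φ hφ] at hα
        refine ⟨h₀.eval t, by rw [hh', sq], ?_⟩
        simpa using congrArg (eval t) hα
      · rw [h, ← map_neg, ← map_mul, ← map_add, map_eq_zero_iff φ hφ] at hα
        refine ⟨-h₀.eval t, by rw [hh', neg_sq, sq], ?_⟩
        simpa using congrArg (eval t) hα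
    · obtain ⟨h0, h3⟩ := eq_zero_of_add_mul_sqrt_eq_zero hφ hm
        (s := s₁ * s₂) (by rw [mul_pow, hs₁, hs₂, map_mul]) hα
      refine ⟨√(f₁.eval t * f₂.eval t), Real.sq_sqrt ?_, by simp [h0, h3]⟩
      simp only [hf₁, hf₂, eval_monicQuadratic]
      exact mul_nonneg (by nlinarith [sq_nonneg r₁]) ht₂.le
  obtain ⟨η, hη, hrel⟩ := hη
  have hD' : (evalRingHom t ∘ w₁) ⬝ᵥ (evalRingHom t ∘ w₂) ⨯₃ (evalRingHom t ∘ w₃) ≠ 0 := by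
    rwa [← map_cross, ← RingHom.map_dotProduct]
  refine false_of_cramer_relation (f₁ := f₁.eval t) (f₂ := f₂.eval t) (f₃ := f₃.eval t)
    (r₁ := r₁) (r₃ := r₃) (η := η) hD' ?_ ?_ ?_ ?_ hη ?_
  · rw [hw₁]
    simp [hf₁, dotProduct, Fin.sum_univ_three]
    linear_combination hg₁
  · rw [hw₃]
    simp [hf₃, dotProduct, Fin.sum_univ_three]
    linear_combination hg₃
  · simpa [hf₁] using ht₁
  · simpa [hf₃] using ht₃
  · simp only [← map_cross, ← RingHom.map_dotProduct]
    simp only [hEv, hP₀, hP₃, map_sub, map_add, map_mul, map_pow, map_ofNat] at hrel ⊢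
    linear_combination hrel

end NonCoplanar

section CommonTangentGerms

open Polynomial Matrix Filter

theorem eq_zero_of_dotProduct_eq_zero {K : Type*} [Field K] {w₁ w₂ w₃ u : Fin 3 → K}
    (hD : w₁ ⬝ᵥ w₂ ⨯₃ w₃ ≠ 0) (h₁ : w₁ ⬝ᵥ u = 0) (h₂ : w₂ ⬝ᵥ u = 0) (h₃ : w₃ ⬝ᵥ u = 0) :
    u = 0 := by
  have := cramerVec_dotProduct w₁ w₂ w₃ u
  rw [h₁, h₂, h₃] at this
  refine (smul_eq_zero.1 (this.symm.trans ?_)).resolve_left hD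
  simp [cramerVec]

theorem cramerVec_mul {R : Type*} [CommRing R] (w₁ w₂ w₃ : Fin 3 → R) (k s₁ s₂ s₃ : R) :
    cramerVec w₁ w₂ w₃ (k * s₁) (k * s₂) (k * s₃) = k • cramerVec w₁ w₂ w₃ s₁ s₂ s₃ := by
  simp [cramerVec, mul_smul]

variable {K : Type*} [Field K] {φ : ℝ[X] →+* K}

theorem exists_sign_of_sq_eq {a : ℝ} {s : K} (hs : s ^ 2 = φ (monicQuadratic a 0)) :
    ∃ ε : ℝ, (ε = 1 ∨ ε = -1) ∧ s = φ (C ε * (X - C a)) := by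
  rw [monicQuadratic, map_zero, add_zero, map_pow] at hs
  rcases sq_eq_sq_iff_eq_or_eq_neg.1 hs with h | h
  · exact ⟨1, Or.inl rfl, by simpa using h⟩
  · exact ⟨-1, Or.inr rfl, by simpa using h⟩

theorem sq_eq_one_of_noncoplanar (hφ : Function.Injective φ)
    {a₁ b₁ c₁ g₁ a₂ b₂ c₂ g₂ a₃ b₃ c₃ g₃ r₁ r₂ r₃ : ℝ} {v : Fin 3 → K} (hv : v ⬝ᵥ v = 1)
    (hD : centerVec a₁ b₁ c₁ ⬝ᵥ centerVec a₂ b₂ c₂ ⨯₃ centerVec a₃ b₃ c₃ ≠ 0)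
    (hg₁ : b₁ ^ 2 + c₁ ^ 2 = g₁ + r₁ ^ 2) (hg₂ : b₂ ^ 2 + c₂ ^ 2 = g₂ + r₂ ^ 2)
    (hg₃ : b₃ ^ 2 + c₃ ^ 2 = g₃ + r₃ ^ 2)
    (hs₁ : ((φ ∘ centerVec a₁ b₁ c₁) ⬝ᵥ v) ^ 2 = φ (monicQuadratic a₁ g₁))
    (hs₂ : ((φ ∘ centerVec a₂ b₂ c₂) ⬝ᵥ v) ^ 2 = φ (monicQuadratic a₂ g₂))
    (hs₃ : ((φ ∘ centerVec a₃ b₃ c₃) ⬝ᵥ v) ^ 2 = φ (monicQuadratic a₃ g₃)) :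
    v 0 ^ 2 = 1 := by
  have hD₂ := hD
  rw [triple_product_permutation] at hD₂
  have hD₃ := hD₂
  rw [triple_product_permutation] at hD₃
  have hE := cramerVec_map_eq (w₁ := φ ∘ centerVec a₁ b₁ c₁) (w₂ := φ ∘ centerVec a₂ b₂ c₂)
    (w₃ := φ ∘ centerVec a₃ b₃ c₃) hv
  have hDφ : (φ ∘ centerVec a₁ b₁ c₁) ⬝ᵥ (φ ∘ centerVec a₂ b₂ c₂) ⨯₃ (φ ∘ centerVec a₃ b₃ c₃)
      ≠ 0 := by
    rw [← map_cross, ← RingHom.map_dotProduct]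
    exact (map_ne_zero_iff φ hφ).2 hD
  have hDev : ∀ᶠ t : ℝ in atTop,
      (![a₁ - t, b₁, c₁] : Fin 3 → ℝ) ⬝ᵥ ![a₂ - t, b₂, c₂] ⨯₃ ![a₃ - t, b₃, c₃] ≠ 0 := by
    filter_upwards [eventually_atTop_not_isRoot _ hD] with t ht
    rwa [← eval_comp_centerVec, ← eval_comp_centerVec, ← eval_comp_centerVec, ← map_cross,
      ← RingHom.map_dotProduct]
  have he (a b c : ℝ) (u : K) : (φ ∘ centerVec a b c) ⬝ᵥ ![u, 0, 0] = φ (C a - X) * u := by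
    simp [centerVec, dotProduct, Fin.sum_univ_three]
  rcases monicQuadratic_classes a₁ a₂ a₃ g₁ g₂ g₃ with
    ⟨h1, h2, h3, h4⟩ | ⟨h1, h2, h3⟩ | ⟨h1, h2⟩ | ⟨h1, h2⟩ | ⟨h1, h2⟩
  · subst h1 h2 h3 h4
    obtain ⟨ε₂, hε₂, hs₂'⟩ : ∃ ε : ℝ, (ε = 1 ∨ ε = -1) ∧
        (φ ∘ centerVec a₂ b₂ c₂) ⬝ᵥ v = (φ ∘ centerVec a₂ b₁ c₁) ⬝ᵥ v * φ (C ε) := by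
      rw [← hs₁] at hs₂
      rcases sq_eq_sq_iff_eq_or_eq_neg.1 hs₂ with h | h
      · exact ⟨1, Or.inl rfl, by simpa using h⟩
      · exact ⟨-1, Or.inr rfl, by simpa using h⟩
    obtain ⟨ε₃, hε₃, hs₃'⟩ : ∃ ε : ℝ, (ε = 1 ∨ ε = -1) ∧
        (φ ∘ centerVec a₂ b₃ c₃) ⬝ᵥ v = (φ ∘ centerVec a₂ b₁ c₁) ⬝ᵥ v * φ (C ε) := by
      rw [← hs₁] at hs₃
      rcases sq_eq_sq_iff_eq_or_eq_neg.1 hs₃ with h | h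
      · exact ⟨1, Or.inl rfl, by simpa using h⟩
      · exact ⟨-1, Or.inr rfl, by simpa using h⟩
    have hs₁' : (φ ∘ centerVec a₂ b₁ c₁) ⬝ᵥ v = (φ ∘ centerVec a₂ b₁ c₁) ⬝ᵥ v * φ (C 1) := by
      simp
    rw [hs₁', hs₂', hs₃', cramerVec_mul,
      dotProduct_smul, smul_dotProduct,
      smul_eq_mul, smul_eq_mul, ← mul_assoc, ← sq, hs₁, ← map_cramerVec, ← RingHom.map_dotProduct,
      ← map_cross, ← RingHom.map_dotProduct, ← map_mul, ← map_pow] at hE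
    have hE' := hφ hE
    have hbd : ∀ᶠ t : ℝ in atTop,
        ((t - a₂) ^ 2 + g₂) * (1 - ε₂) ^ 2 ≤ (b₁ - b₂) ^ 2 + (c₁ - c₂) ^ 2 ∧
        ((t - a₂) ^ 2 + g₂) * (ε₂ - ε₃) ^ 2 ≤ (b₂ - b₃) ^ 2 + (c₂ - c₃) ^ 2 := by
      filter_upwards [hDev, eventually_lt_sq_sub_add a₂ g₂ 0] with t ht hpos
      have hEt := congrArg (evalRingHom t) hE'
      rw [map_mul, RingHom.map_dotProduct, map_cramerVec, map_pow, RingHom.map_dotProduct,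
        map_cross] at hEt
      simp only [eval_comp_centerVec] at hEt
      simp only [coe_evalRingHom, eval_C, eval_monicQuadratic] at hEt
      have hsq := Real.sq_sqrt hpos.le
      have := sq_sub_le_of_cramerVec (s₁ := √((t - a₂) ^ 2 + g₂) * 1)
        (s₂ := √((t - a₂) ^ 2 + g₂) * ε₂) (s₃ := √((t - a₂) ^ 2 + g₂) * ε₃) ht (by
          rw [cramerVec_mul, dotProduct_smul, smul_dotProduct, smul_eq_mul, smul_eq_mul,
            ← mul_assoc, ← sq, hsq, hEt])
      rw [← mul_sub, ← mul_sub, mul_pow, mul_pow, hsq] at this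
      simpa [dotProduct, Fin.sum_univ_three, ← sq] using this
    have hne (ε M : ℝ) (hε : ε = 2 ∨ ε = -2)
        (h : ∀ᶠ t : ℝ in atTop, ((t - a₂) ^ 2 + g₂) * ε ^ 2 ≤ M) : False := by
      obtain ⟨t, h1, h2⟩ := (h.and (eventually_lt_sq_sub_add a₂ g₂ (M / 4))).exists
      have : ε ^ 2 = 4 := by rcases hε with rfl | rfl <;> norm_num
      rw [this] at h1
      linarith
    obtain rfl : ε₂ = 1 := by
      rcases hε₂ with rfl | rfl
      · rfl
      · exact (hne (1 - -1) _ (by norm_num) (hbd.mono fun t h => h.1)).elim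
    obtain rfl : ε₃ = 1 := by
      rcases hε₃ with rfl | rfl
      · rfl
      · exact (hne (1 - -1) _ (by norm_num) (hbd.mono fun t h => h.2)).elim
    rw [map_one, map_one, mul_one] at hs₂' hs₃'
    set s := (φ ∘ centerVec a₂ b₁ c₁) ⬝ᵥ v with hs
    have hu := eq_zero_of_dotProduct_eq_zero (u := φ (C a₂ - X) • v - ![s, 0, 0]) hDφ
      (by rw [dotProduct_sub, dotProduct_smul, he, smul_eq_mul, sub_self])
      (by rw [dotProduct_sub, dotProduct_smul, he, smul_eq_mul, hs₂', sub_self])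
      (by rw [dotProduct_sub, dotProduct_smul, he, smul_eq_mul, hs₃', sub_self])
    have hX : φ (C a₂ - X) ≠ 0 := by
      rw [map_ne_zero_iff φ hφ]
      intro h
      simpa using congrArg (eval (a₂ - 1)) h
    have hu1 : v 1 = 0 := by simpa [hX, ← map_sub, -map_sub] using congrFun hu 1
    have hu2 : v 2 = 0 := by simpa [hX, ← map_sub, -map_sub] using congrFun hu 2
    simpa [dotProduct, Fin.sum_univ_three, hu1, hu2, ← sq] using hv
  · subst h1 h2 h3
    obtain ⟨ε₁, hε₁, hs₁'⟩ := exists_sign_of_sq_eq hs₁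
    obtain ⟨ε₂, hε₂, hs₂'⟩ := exists_sign_of_sq_eq hs₂
    obtain ⟨ε₃, hε₃, hs₃'⟩ := exists_sign_of_sq_eq hs₃
    rw [hs₁', hs₂', hs₃', ← map_cramerVec, ← RingHom.map_dotProduct,
      ← map_cross, ← RingHom.map_dotProduct, ← map_pow] at hE
    have hE' := hφ hE
    have hbd : ∀ᶠ t : ℝ in atTop,
        (ε₁ * (t - a₁) - ε₂ * (t - a₂)) ^ 2 ≤
          (a₁ - a₂) ^ 2 + (b₁ - b₂) ^ 2 + (c₁ - c₂) ^ 2 ∧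
        (ε₂ * (t - a₂) - ε₃ * (t - a₃)) ^ 2 ≤
          (a₂ - a₃) ^ 2 + (b₂ - b₃) ^ 2 + (c₂ - c₃) ^ 2 := by
      filter_upwards [hDev] with t ht
      have hEt := congrArg (evalRingHom t) hE'
      rw [RingHom.map_dotProduct, map_cramerVec, map_pow, RingHom.map_dotProduct,
        map_cross] at hEt
      simp only [eval_comp_centerVec] at hEt
      simp only [coe_evalRingHom, eval_C, eval_mul, eval_sub, eval_X] at hEt
      have := sq_sub_le_of_cramerVec ht hEt
      simpa [dotProduct, Fin.sum_univ_three, ← sq] using this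
    have hne (a a' M : ℝ)
        (h : ∀ᶠ t : ℝ in atTop, ((t - a) + (t - a')) ^ 2 ≤ M) : False := by
      obtain ⟨t, h1, h2⟩ := (h.and (eventually_lt_sq_sub_add ((a + a') / 2) 0 (M / 4))).exists
      linarith
    obtain rfl : ε₁ = ε₂ := by
      rcases hε₁ with rfl | rfl <;> rcases hε₂ with rfl | rfl
      · rfl
      · exact (hne a₁ a₂ _ (hbd.mono fun t h => le_trans (le_of_eq (by ring)) h.1)).elim
      · exact (hne a₁ a₂ _ (hbd.mono fun t h => le_trans (le_of_eq (by ring)) h.1)).elim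
      · rfl
    obtain rfl : ε₁ = ε₃ := by
      rcases hε₁ with rfl | rfl <;> rcases hε₃ with rfl | rfl
      · rfl
      · exact (hne a₂ a₃ _ (hbd.mono fun t h => le_trans (le_of_eq (by ring)) h.2)).elim
      · exact (hne a₂ a₃ _ (hbd.mono fun t h => le_trans (le_of_eq (by ring)) h.2)).elim
      · rfl
    have hz (a b c : ℝ) (h : (φ ∘ centerVec a b c) ⬝ᵥ v = φ (C ε₁ * (X - C a))) :
        (φ ∘ centerVec a b c) ⬝ᵥ (v + ![φ (C ε₁), 0, 0]) = 0 := by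
      rw [dotProduct_add, he, h, ← map_mul, ← map_add, map_eq_zero_iff φ hφ]
      ring
    have hu := eq_zero_of_dotProduct_eq_zero hDφ (hz _ _ _ hs₁') (hz _ _ _ hs₂') (hz _ _ _ hs₃')
    have hv0 : v 0 + φ (C ε₁) = 0 := by simpa using congrFun hu 0
    rw [eq_neg_of_add_eq_zero_left hv0, neg_sq]
    rcases hε₁ with rfl | rfl <;> simp
  · exact (false_of_isolated_class hφ hv hD h1 h2 hg₁ hg₃ hs₁ hs₂ hs₃).elim
  · exact (false_of_isolated_class hφ hv hD₂ h1 h2 hg₂ hg₁ hs₂ hs₃ hs₁).elim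
  · exact (false_of_isolated_class hφ hv hD₃ h1 h2 hg₃ hg₂ hs₃ hs₁ hs₂).elim

end CommonTangentGerms

section Coplanar

open Polynomial Matrix Filter

variable {K : Type*} [Field K] {φ : ℝ[X] →+* K}

/-- The determinant of the vectors `(a - X, b)` and `(a' - X, b')`. -/
def pencilDet (a b a' b' : ℝ) : ℝ[X] := (C a - X) * C b' - (C a' - X) * C b

theorem pencilDet_eq_zero {a b a' b' : ℝ} (h : pencilDet a b a' b' = 0) :
    b = b' ∧ a * b' = a' * b := by
  have h0 := congrArg (eval 0) h
  have h1 := congrArg (eval 1) h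
  simp [pencilDet] at h0 h1
  constructor <;> linarith

theorem false_of_isolated_class_of_coplanar (hφ : Function.Injective φ)
    {a₁ b₁ g₁ a₂ b₂ g₂ a₃ b₃ g₃ r₁ : ℝ} {x y : K}
    (hD : (a₂ - a₁) * (b₃ - b₁) - (a₃ - a₁) * (b₂ - b₁) ≠ 0)
    (h₁₃ : ¬ IsSquare (monicQuadratic a₁ g₁ * monicQuadratic a₃ g₃))
    (h₂₃ : ¬ IsSquare (monicQuadratic a₂ g₂ * monicQuadratic a₃ g₃))
    (hr₁ : 0 < r₁) (hg₁ : b₁ ^ 2 = g₁ + r₁ ^ 2)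
    (hs₁ : (φ (C a₁ - X) * x + φ (C b₁) * y) ^ 2 = φ (monicQuadratic a₁ g₁))
    (hs₂ : (φ (C a₂ - X) * x + φ (C b₂) * y) ^ 2 = φ (monicQuadratic a₂ g₂))
    (hs₃ : (φ (C a₃ - X) * x + φ (C b₃) * y) ^ 2 = φ (monicQuadratic a₃ g₃)) : False := by
  have hrel : φ (pencilDet a₂ b₂ a₃ b₃) * (φ (C a₁ - X) * x + φ (C b₁) * y) +
      φ (pencilDet a₃ b₃ a₁ b₁) * (φ (C a₂ - X) * x + φ (C b₂) * y) +
      φ (pencilDet a₁ b₁ a₂ b₂) * (φ (C a₃ - X) * x + φ (C b₃) * y) = 0 := by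
    simp only [pencilDet, map_sub, map_mul]
    ring
  have hP := coeff_eq_zero_of_sqrt_relation hφ (monicQuadratic_ne_zero a₁ g₁)
    (monicQuadratic_ne_zero a₃ g₃) h₁₃ h₂₃ hs₁ hs₂ hs₃ hrel
  obtain ⟨hb, hab⟩ := pencilDet_eq_zero hP
  subst hb
  have ha : a₂ - a₁ ≠ 0 := by rintro h; apply hD; rw [h]; ring
  have hb : b₁ = 0 := by
    have : (a₂ - a₁) * b₁ = 0 := by linear_combination -hab
    exact (mul_eq_zero.1 this).resolve_left ha
  subst hb
  have hb₃ : b₃ ≠ 0 := by rintro rfl; apply hD; ring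
  rw [hP, map_zero φ, zero_mul, add_zero] at hrel
  have hpoly : (pencilDet a₂ 0 a₃ b₃) ^ 2 * monicQuadratic a₁ g₁ =
      (pencilDet a₃ b₃ a₁ 0) ^ 2 * monicQuadratic a₂ g₂ := by
    apply hφ
    rw [map_mul, map_mul, map_pow, map_pow, ← hs₁, ← hs₂, ← mul_pow, ← mul_pow,
      eq_neg_of_add_eq_zero_left hrel, neg_sq]
  have := congrArg (eval a₁) hpoly
  simp [pencilDet] at this
  rcases this with (h | h) | h
  · exact ha h
  · exact hb₃ h
  · nlinarith

theorem sq_eq_one_of_coplanar (hφ : Function.Injective φ)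
    {a₁ b₁ g₁ a₂ b₂ g₂ a₃ b₃ g₃ r₁ r₂ r₃ : ℝ} {x y : K}
    (hD : (a₂ - a₁) * (b₃ - b₁) - (a₃ - a₁) * (b₂ - b₁) ≠ 0)
    (hr₁ : 0 < r₁) (hr₂ : 0 < r₂) (hr₃ : 0 < r₃)
    (hg₁ : b₁ ^ 2 = g₁ + r₁ ^ 2) (hg₂ : b₂ ^ 2 = g₂ + r₂ ^ 2) (hg₃ : b₃ ^ 2 = g₃ + r₃ ^ 2)
    (hs₁ : (φ (C a₁ - X) * x + φ (C b₁) * y) ^ 2 = φ (monicQuadratic a₁ g₁))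
    (hs₂ : (φ (C a₂ - X) * x + φ (C b₂) * y) ^ 2 = φ (monicQuadratic a₂ g₂))
    (hs₃ : (φ (C a₃ - X) * x + φ (C b₃) * y) ^ 2 = φ (monicQuadratic a₃ g₃)) :
    x ^ 2 = 1 := by
  have hD₂ : (a₃ - a₂) * (b₁ - b₂) - (a₁ - a₂) * (b₃ - b₂) ≠ 0 := by convert hD using 1; ring
  have hD₃ : (a₁ - a₃) * (b₂ - b₃) - (a₂ - a₃) * (b₁ - b₃) ≠ 0 := by convert hD using 1; ring
  rcases monicQuadratic_classes a₁ a₂ a₃ g₁ g₂ g₃ with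
    ⟨h1, h2, -, -⟩ | ⟨h1, h2, h3⟩ | ⟨h1, h2⟩ | ⟨h1, h2⟩ | ⟨h1, h2⟩
  · exact (hD (by rw [h1, h2]; ring)).elim
  · subst h1 h2 h3
    obtain ⟨ε₁, hε₁, hs₁'⟩ := exists_sign_of_sq_eq hs₁
    obtain ⟨ε₂, hε₂, hs₂'⟩ := exists_sign_of_sq_eq hs₂
    obtain ⟨ε₃, hε₃, hs₃'⟩ := exists_sign_of_sq_eq hs₃
    have hrel : pencilDet a₂ b₂ a₃ b₃ * (C ε₁ * (X - C a₁)) +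
        pencilDet a₃ b₃ a₁ b₁ * (C ε₂ * (X - C a₂)) +
        pencilDet a₁ b₁ a₂ b₂ * (C ε₃ * (X - C a₃)) = 0 := by
      apply hφ
      rw [map_add, map_add, map_mul, map_mul _ _ (C ε₂ * _), map_mul _ _ (C ε₃ * _), ← hs₁',
        ← hs₂', ← hs₃', map_zero]
      simp only [pencilDet, map_sub, map_mul]
      ring
    have htriv : pencilDet a₂ b₂ a₃ b₃ * (X - C a₁) +
        pencilDet a₃ b₃ a₁ b₁ * (X - C a₂) + pencilDet a₁ b₁ a₂ b₂ * (X - C a₃) = 0 := by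
      simp only [pencilDet]
      ring
    have hne {a b a' b' a'' b'' r : ℝ} (hr : 0 < r) (hg : b ^ 2 = 0 + r ^ 2)
        (hD : (a' - a) * (b'' - b) - (a'' - a) * (b' - b) ≠ 0)
        (h : 2 * (pencilDet a b a' b' * (X - C a'')) = 0) : False := by
      obtain ⟨hb, hab⟩ := pencilDet_eq_zero ((mul_eq_zero.1
        ((mul_eq_zero.1 h).resolve_left two_ne_zero)).resolve_right (X_sub_C_ne_zero a''))
      subst hb
      have hb : b ≠ 0 := by rintro rfl; nlinarith
      apply hD
      rw [mul_right_cancel₀ hb hab]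
      ring
    have hC1 : (C (-1) : ℝ[X]) = -1 := by simp
    have h12 : ε₁ = ε₂ ∧ ε₁ = ε₃ := by
      rcases hε₁ with rfl | rfl <;> rcases hε₂ with rfl | rfl <;> rcases hε₃ with rfl | rfl <;>
      first
      | exact ⟨rfl, rfl⟩
      | exfalso
        rw [C_1, hC1] at hrel
        first
        | refine hne hr₁ hg₁ hD ?_; linear_combination htriv - hrel
        | refine hne hr₁ hg₁ hD ?_; linear_combination htriv + hrel
        | refine hne hr₂ hg₂ hD₂ ?_; linear_combination htriv - hrel
        | refine hne hr₂ hg₂ hD₂ ?_; linear_combination htriv + hrel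
        | refine hne hr₃ hg₃ hD₃ ?_; linear_combination htriv - hrel
        | refine hne hr₃ hg₃ hD₃ ?_; linear_combination htriv + hrel
    obtain ⟨rfl, rfl⟩ := h12
    have hP : φ (pencilDet a₁ b₁ a₂ b₂) ≠ 0 := by
      rw [map_ne_zero_iff φ hφ]
      intro h
      exact hne hr₁ hg₁ hD (by rw [h, zero_mul, mul_zero])
    have hx : φ (pencilDet a₁ b₁ a₂ b₂) * (x + φ (C ε₁)) = 0 := by
      simp only [pencilDet, map_sub, map_mul] at hs₁' hs₂' ⊢
      linear_combination φ (C b₂) * hs₁' - φ (C b₁) * hs₂'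
    rw [eq_neg_of_add_eq_zero_left ((mul_eq_zero.1 hx).resolve_left hP), neg_sq]
    rcases hε₁ with rfl | rfl <;> simp
  · exact (false_of_isolated_class_of_coplanar hφ hD h1 h2 hr₁ hg₁ hs₁ hs₂ hs₃).elim
  · exact (false_of_isolated_class_of_coplanar hφ hD₂ h1 h2 hr₂ hg₂ hs₂ hs₃ hs₁).elim
  · exact (false_of_isolated_class_of_coplanar hφ hD₃ h1 h2 hr₃ hg₃ hs₃ hs₁ hs₂).elim

theorem eq_of_linear_relation (hφ : Function.Injective φ)
    {a₁ g₁ a₂ g₂ a₃ g₃ l : ℝ} {s₁ s₂ s₃ : K} (hl₀ : l ≠ 0) (hl₁ : l ≠ 1)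
    (hs₁ : s₁ ^ 2 = φ (monicQuadratic a₁ g₁)) (hs₂ : s₂ ^ 2 = φ (monicQuadratic a₂ g₂))
    (hs₃ : s₃ ^ 2 = φ (monicQuadratic a₃ g₃)) (h : s₃ = s₁ + φ (C l) * (s₂ - s₁)) :
    (g₁ = 0 ∧ g₂ = 0 ∧ g₃ = 0 ∧ ∃ ε : ℝ, (ε = 1 ∨ ε = -1) ∧ s₁ = φ (C ε * (X - C a₁)) ∧
      s₂ = φ (C ε * (X - C a₂))) ∨
    (a₁ = a₃ ∧ a₂ = a₃ ∧ g₁ = g₃ ∧ g₂ = g₃ ∧ s₁ = s₂) := by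
  have hl₁' : 1 - l ≠ 0 := sub_ne_zero.2 hl₁.symm
  rcases monicQuadratic_classes a₁ a₂ a₃ g₁ g₂ g₃ with
    ⟨h1, h2, h3, h4⟩ | ⟨h1, h2, h3⟩ | ⟨h1, h2⟩ | ⟨h1, h2⟩ | ⟨h1, h2⟩
  · right
    refine ⟨h1, h2, h3, h4, ?_⟩
    subst h1 h2 h3 h4
    have h12 := sq_eq_sq_iff_eq_or_eq_neg.1 (hs₁.trans hs₂.symm)
    have h13 := sq_eq_sq_iff_eq_or_eq_neg.1 (hs₁.trans hs₃.symm)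
    rcases h12 with h12 | h12
    · exact h12
    have hs₁0 : s₁ ≠ 0 := by
      rintro rfl
      rw [zero_pow two_ne_zero, eq_comm, map_eq_zero_iff φ hφ] at hs₁
      exact monicQuadratic_ne_zero _ _ hs₁
    have hs₂' : s₂ = -s₁ := by rw [h12, neg_neg]
    subst hs₂'
    rcases h13 with h13 | h13
    · have : φ (C (2 * l)) * s₁ = 0 := by
        rw [C_mul, map_mul, C_ofNat, map_ofNat]
        linear_combination h13 + h
      rcases mul_eq_zero.1 this with h' | h'
      · rw [map_eq_zero_iff φ hφ, C_eq_zero] at h'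
        exact (hl₀ (by linarith)).elim
      · exact (hs₁0 h').elim
    · have : φ (C (2 * (1 - l))) * s₁ = 0 := by
        rw [C_mul, map_mul, C_ofNat, map_ofNat, C_sub, C_1, map_sub, map_one]
        linear_combination h13 - h
      rcases mul_eq_zero.1 this with h' | h'
      · rw [map_eq_zero_iff φ hφ, C_eq_zero] at h'
        exact (hl₁ (by linarith)).elim
      · exact (hs₁0 h').elim
  · left
    subst h1 h2 h3
    obtain ⟨ε₁, hε₁, rfl⟩ := exists_sign_of_sq_eq hs₁
    obtain ⟨ε₂, hε₂, rfl⟩ := exists_sign_of_sq_eq hs₂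
    obtain ⟨ε₃, hε₃, rfl⟩ := exists_sign_of_sq_eq hs₃
    refine ⟨rfl, rfl, rfl, ε₁, hε₁, rfl, ?_⟩
    rw [← map_sub, ← map_mul, ← map_add] at h
    have h' := hφ h
    have e0 := congrArg (eval 0) h'
    have e1 := congrArg (eval 1) h'
    simp at e0 e1
    have e2 : ε₃ = ε₁ + l * (ε₂ - ε₁) := by linear_combination e1 - e0
    obtain rfl : ε₂ = ε₁ := by
      rcases hε₁ with rfl | rfl <;> rcases hε₂ with rfl | rfl <;> rcases hε₃ with rfl | rfl <;>
      first
      | rfl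
      | exact (hl₀ (by linarith)).elim
      | exact (hl₁ (by linarith)).elim
    rfl
  · have := coeff_eq_zero_of_sqrt_relation (P₁ := C (1 - l)) (P₂ := C l) (P₃ := C (-1)) hφ
      (monicQuadratic_ne_zero _ _) (monicQuadratic_ne_zero _ _) h1 h2 hs₁ hs₂ hs₃ (by
        simp only [map_neg, map_sub, map_one]
        linear_combination -h)
    simp at this
  · have := coeff_eq_zero_of_sqrt_relation (P₃ := C (1 - l)) (P₁ := C l) (P₂ := C (-1)) hφ
      (monicQuadratic_ne_zero _ _) (monicQuadratic_ne_zero _ _) h1 h2 hs₂ hs₃ hs₁ (by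
        simp only [map_neg, map_sub, map_one]
        linear_combination -h)
    exact (hl₁' (C_eq_zero.1 this)).elim
  · have := coeff_eq_zero_of_sqrt_relation (P₂ := C (1 - l)) (P₃ := C l) (P₁ := C (-1)) hφ
      (monicQuadratic_ne_zero _ _) (monicQuadratic_ne_zero _ _) h1 h2 hs₃ hs₁ hs₂ (by
        simp only [map_neg, map_sub, map_one]
        linear_combination -h)
    exact (hl₀ (C_eq_zero.1 this)).elim

end Coplanar

section Collinear

open Polynomial Matrix Filter

theorem exists_eq_mul_of_cross_eq_zero {A B C A' B' C' : ℝ} (h : ¬ (A = 0 ∧ B = 0 ∧ C = 0))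
    (h₁ : A * B' = A' * B) (h₂ : A * C' = A' * C) (h₃ : B * C' = B' * C) :
    ∃ l : ℝ, A' = l * A ∧ B' = l * B ∧ C' = l * C := by
  have hn : A ^ 2 + B ^ 2 + C ^ 2 ≠ 0 := by
    intro hn
    apply h
    refine ⟨?_, ?_, ?_⟩ <;> nlinarith [sq_nonneg A, sq_nonneg B, sq_nonneg C]
  refine ⟨(A * A' + B * B' + C * C') / (A ^ 2 + B ^ 2 + C ^ 2), ?_, ?_, ?_⟩ <;> field_simp
  · linear_combination -B * h₁ - C * h₂
  · linear_combination A * h₁ - C * h₃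
  · linear_combination A * h₂ + B * h₃

variable {K : Type*} [Field K] {φ : ℝ[X] →+* K}

theorem comp_centerVec_dotProduct (a b c : ℝ) (v : Fin 3 → K) :
    (φ ∘ centerVec a b c) ⬝ᵥ v = φ (C a - X) * v 0 + φ (C b) * v 1 + φ (C c) * v 2 := by
  simp [centerVec, dotProduct, Fin.sum_univ_three]

theorem radius_eq_of_center_eq (hφ : Function.Injective φ) {a b c g g' r r' : ℝ} {v : Fin 3 → K}
    (hr : 0 < r) (hr' : 0 < r') (hg : b ^ 2 + c ^ 2 = g + r ^ 2)
    (hg' : b ^ 2 + c ^ 2 = g' + r' ^ 2)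
    (hs : ((φ ∘ centerVec a b c) ⬝ᵥ v) ^ 2 = φ (monicQuadratic a g))
    (hs' : ((φ ∘ centerVec a b c) ⬝ᵥ v) ^ 2 = φ (monicQuadratic a g')) : r = r' := by
  have := congrArg (eval a) (hφ (hs.symm.trans hs'))
  simp at this
  rw [← sq_eq_sq₀ hr.le hr'.le]
  linarith

theorem cross_eq_zero_of_coplanar (hφ : Function.Injective φ)
    {a₁ b₁ c₁ g₁ a₂ b₂ c₂ g₂ a₃ b₃ c₃ g₃ r₁ r₂ r₃ : ℝ} {v : Fin 3 → K} (hv₀ : v 0 ^ 2 ≠ 1)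
    (hr₁ : 0 < r₁) (hr₂ : 0 < r₂) (hr₃ : 0 < r₃)
    (hD : centerVec a₁ b₁ c₁ ⬝ᵥ centerVec a₂ b₂ c₂ ⨯₃ centerVec a₃ b₃ c₃ = 0)
    (hg₁ : b₁ ^ 2 + c₁ ^ 2 = g₁ + r₁ ^ 2) (hg₂ : b₂ ^ 2 + c₂ ^ 2 = g₂ + r₂ ^ 2)
    (hg₃ : b₃ ^ 2 + c₃ ^ 2 = g₃ + r₃ ^ 2)
    (hs₁ : ((φ ∘ centerVec a₁ b₁ c₁) ⬝ᵥ v) ^ 2 = φ (monicQuadratic a₁ g₁))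
    (hs₂ : ((φ ∘ centerVec a₂ b₂ c₂) ⬝ᵥ v) ^ 2 = φ (monicQuadratic a₂ g₂))
    (hs₃ : ((φ ∘ centerVec a₃ b₃ c₃) ⬝ᵥ v) ^ 2 = φ (monicQuadratic a₃ g₃)) :
    (a₂ - a₁) * (b₃ - b₁) = (a₃ - a₁) * (b₂ - b₁) ∧
    (a₂ - a₁) * (c₃ - c₁) = (a₃ - a₁) * (c₂ - c₁) ∧
    (b₂ - b₁) * (c₃ - c₁) = (b₃ - b₁) * (c₂ - c₁) := by
  have h0 := congrArg (eval 0) hD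
  have h1 := congrArg (eval 1) hD
  simp [centerVec, cross_apply, dotProduct, Fin.sum_univ_three] at h0 h1
  have h3 : (b₂ - b₁) * (c₃ - c₁) = (b₃ - b₁) * (c₂ - c₁) := by linear_combination h0 - h1
  by_contra hne
  apply hv₀
  set p := (a₂ - a₁) * (b₃ - b₁) - (a₃ - a₁) * (b₂ - b₁) with hp
  set q := (a₂ - a₁) * (c₃ - c₁) - (a₃ - a₁) * (c₂ - c₁) with hq
  have hpq : 0 < p ^ 2 + q ^ 2 := by
    by_contra! hle
    apply hne
    have hp0 : p = 0 := by
      rw [← sq_eq_zero_iff]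
      exact le_antisymm (by linarith only [hle, sq_nonneg q]) (sq_nonneg p)
    have hq0 : q = 0 := by
      rw [← sq_eq_zero_iff]
      exact le_antisymm (by linarith only [hle, sq_nonneg p]) (sq_nonneg q)
    exact ⟨sub_eq_zero.1 hp0, sub_eq_zero.1 hq0, h3⟩
  have hb₁ : b₁ * q = c₁ * p := by rw [hp, hq]; linear_combination -h0 + a₁ * h3
  have hb₂ : b₂ * q = c₂ * p := by
    rw [hp, hq]; rw [hp, hq] at hb₁; linear_combination hb₁ + (a₂ - a₁) * h3
  have hb₃ : b₃ * q = c₃ * p := by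
    rw [hp, hq]; rw [hp, hq] at hb₁; linear_combination hb₁ + (a₃ - a₁) * h3
  have hν := Real.sq_sqrt hpq.le
  have hν0 : √(p ^ 2 + q ^ 2) ≠ 0 := (Real.sqrt_pos.2 hpq).ne'
  set ν := √(p ^ 2 + q ^ 2)
  have hb {b c : ℝ} (h : b * q = c * p) : (b * p + c * q) / ν * (p / ν) = b := by
    field_simp; rw [hν]; linear_combination -q * h
  have hc {b c : ℝ} (h : b * q = c * p) : (b * p + c * q) / ν * (q / ν) = c := by
    field_simp; rw [hν]; linear_combination p * h
  have hg {b c g r : ℝ} (h : b * q = c * p) (hg : b ^ 2 + c ^ 2 = g + r ^ 2) :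
      ((b * p + c * q) / ν) ^ 2 = g + r ^ 2 := by
    rw [← hg, div_pow, div_eq_iff (pow_ne_zero 2 hν0), hν]
    linear_combination -(b * q - c * p) * h
  have hs {a b c g : ℝ} (h : b * q = c * p)
      (hs : ((φ ∘ centerVec a b c) ⬝ᵥ v) ^ 2 = φ (monicQuadratic a g)) :
      (φ (C a - X) * v 0 + φ (C ((b * p + c * q) / ν)) *
        (φ (C (p / ν)) * v 1 + φ (C (q / ν)) * v 2)) ^ 2 = φ (monicQuadratic a g) := by
    rw [← hs, comp_centerVec_dotProduct, mul_add, ← mul_assoc, ← mul_assoc, ← map_mul, ← C_mul,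
      hb h, ← map_mul, ← C_mul, hc h, ← add_assoc]
  refine sq_eq_one_of_coplanar hφ ?_ hr₁ hr₂ hr₃ (hg hb₁ hg₁) (hg hb₂ hg₂) (hg hb₃ hg₃)
    (hs hb₁ hs₁) (hs hb₂ hs₂) (hs hb₃ hs₃)
  have : (a₂ - a₁) * ((b₃ * p + c₃ * q) / ν - (b₁ * p + c₁ * q) / ν) -
      (a₃ - a₁) * ((b₂ * p + c₂ * q) / ν - (b₁ * p + c₁ * q) / ν) = (p ^ 2 + q ^ 2) / ν := by
    rw [eq_div_iff hν0]
    field_simp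
    rw [hp, hq]
    ring
  rw [this]
  have hpq0 := hpq.ne'
  exact div_ne_zero hpq0 hν0

/-- Generic tangents along a line force collinear centres: either the line itself touches all
three spheres, or the centres lie on a line perpendicular to it. -/
theorem collinear_of_generic_tangent (hφ : Function.Injective φ)
    {a₁ b₁ c₁ a₂ b₂ c₂ a₃ b₃ c₃ r₁ r₂ r₃ : ℝ} {v : Fin 3 → K}
    (hv : v ⬝ᵥ v = 1) (hv₀ : v 0 ^ 2 ≠ 1)
    (hr₁ : 0 < r₁) (hr₂ : 0 < r₂) (hr₃ : 0 < r₃)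
    (h₁₂ : ¬ (a₁ = a₂ ∧ b₁ = b₂ ∧ c₁ = c₂ ∧ r₁ = r₂))
    (h₁₃ : ¬ (a₁ = a₃ ∧ b₁ = b₃ ∧ c₁ = c₃ ∧ r₁ = r₃))
    (h₂₃ : ¬ (a₂ = a₃ ∧ b₂ = b₃ ∧ c₂ = c₃ ∧ r₂ = r₃))
    (hs₁ : ((φ ∘ centerVec a₁ b₁ c₁) ⬝ᵥ v) ^ 2 =
      φ (monicQuadratic a₁ (b₁ ^ 2 + c₁ ^ 2 - r₁ ^ 2)))
    (hs₂ : ((φ ∘ centerVec a₂ b₂ c₂) ⬝ᵥ v) ^ 2 =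
      φ (monicQuadratic a₂ (b₂ ^ 2 + c₂ ^ 2 - r₂ ^ 2)))
    (hs₃ : ((φ ∘ centerVec a₃ b₃ c₃) ⬝ᵥ v) ^ 2 =
      φ (monicQuadratic a₃ (b₃ ^ 2 + c₃ ^ 2 - r₃ ^ 2))) :
    (∃ l : ℝ, a₃ - a₁ = l * (a₂ - a₁) ∧ b₃ - b₁ = l * (b₂ - b₁) ∧ c₃ - c₁ = l * (c₂ - c₁)) ∧
    ((b₁ ^ 2 + c₁ ^ 2 = r₁ ^ 2 ∧ b₂ ^ 2 + c₂ ^ 2 = r₂ ^ 2 ∧ b₃ ^ 2 + c₃ ^ 2 = r₃ ^ 2 ∧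
        ¬ (b₁ = b₂ ∧ c₁ = c₂)) ∨
      (a₁ = a₂ ∧ a₁ = a₃ ∧ ¬ (b₁ = b₂ ∧ c₁ = c₂) ∧
        b₁ ^ 2 + c₁ ^ 2 - r₁ ^ 2 = b₂ ^ 2 + c₂ ^ 2 - r₂ ^ 2 ∧
        b₁ ^ 2 + c₁ ^ 2 - r₁ ^ 2 = b₃ ^ 2 + c₃ ^ 2 - r₃ ^ 2 ∧
        φ (C (b₁ - b₂)) * v 1 + φ (C (c₁ - c₂)) * v 2 = 0)) := by
  have hg (b c r : ℝ) : b ^ 2 + c ^ 2 = (b ^ 2 + c ^ 2 - r ^ 2) + r ^ 2 := by ring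
  have hD : centerVec a₁ b₁ c₁ ⬝ᵥ centerVec a₂ b₂ c₂ ⨯₃ centerVec a₃ b₃ c₃ = 0 := by
    by_contra hD
    exact hv₀ (sq_eq_one_of_noncoplanar hφ hv hD (hg _ _ _) (hg _ _ _) (hg _ _ _) hs₁ hs₂ hs₃)
  obtain ⟨hAB, hAC, hBC⟩ := cross_eq_zero_of_coplanar hφ hv₀ hr₁ hr₂ hr₃ hD (hg _ _ _) (hg _ _ _)
    (hg _ _ _) hs₁ hs₂ hs₃
  have h₁₂' : ¬ (a₂ - a₁ = 0 ∧ b₂ - b₁ = 0 ∧ c₂ - c₁ = 0) := by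
    rintro ⟨h1, h2, h3⟩
    obtain rfl := sub_eq_zero.1 h1
    obtain rfl := sub_eq_zero.1 h2
    obtain rfl := sub_eq_zero.1 h3
    exact h₁₂ ⟨rfl, rfl, rfl, radius_eq_of_center_eq hφ hr₁ hr₂ (hg _ _ _) (hg _ _ _) hs₁ hs₂⟩
  obtain ⟨l, hA, hB, hC⟩ := exists_eq_mul_of_cross_eq_zero h₁₂' hAB hAC hBC
  refine ⟨⟨l, hA, hB, hC⟩, ?_⟩
  have hl₀ : l ≠ 0 := by
    rintro rfl
    rw [zero_mul] at hA hB hC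
    obtain rfl := sub_eq_zero.1 hA
    obtain rfl := sub_eq_zero.1 hB
    obtain rfl := sub_eq_zero.1 hC
    exact h₁₃ ⟨rfl, rfl, rfl, radius_eq_of_center_eq hφ hr₁ hr₃ (hg _ _ _) (hg _ _ _) hs₁ hs₃⟩
  have hl₁ : l ≠ 1 := by
    rintro rfl
    rw [one_mul, sub_left_inj] at hA hB hC
    subst hA hB hC
    exact h₂₃ ⟨rfl, rfl, rfl, radius_eq_of_center_eq hφ hr₂ hr₃ (hg _ _ _) (hg _ _ _) hs₂ hs₃⟩
  have hlin : (φ ∘ centerVec a₃ b₃ c₃) ⬝ᵥ v = (φ ∘ centerVec a₁ b₁ c₁) ⬝ᵥ v + φ (C l) *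
      ((φ ∘ centerVec a₂ b₂ c₂) ⬝ᵥ v - (φ ∘ centerVec a₁ b₁ c₁) ⬝ᵥ v) := by
    obtain rfl : a₃ = a₁ + l * (a₂ - a₁) := by linarith
    obtain rfl : b₃ = b₁ + l * (b₂ - b₁) := by linarith
    obtain rfl : c₃ = c₁ + l * (c₂ - c₁) := by linarith
    simp only [comp_centerVec_dotProduct, map_add, map_mul, map_sub]
    ring
  rcases eq_of_linear_relation hφ hl₀ hl₁ hs₁ hs₂ hs₃ hlin with
    ⟨hg₁, hg₂, hg₃, ε, hε, he₁, he₂⟩ | ⟨h1, h2, h3, h4, h5⟩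
  · refine Or.inl ⟨by linarith, by linarith, by linarith, ?_⟩
    rintro ⟨rfl, rfl⟩
    have ha : a₁ - a₂ ≠ 0 := by
      intro h
      exact h₁₂' ⟨by linarith, sub_self _, sub_self _⟩
    have : φ (C (a₁ - a₂)) * (v 0 + φ (C ε)) = 0 := by
      rw [comp_centerVec_dotProduct] at he₁ he₂
      simp only [map_sub, map_mul] at he₁ he₂ ⊢
      linear_combination he₁ - he₂
    have hv0 := (mul_eq_zero.1 this).resolve_left
      ((map_ne_zero_iff φ hφ).2 (C_ne_zero.2 ha))
    apply hv₀
    rw [eq_neg_of_add_eq_zero_left hv0, neg_sq]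
    rcases hε with rfl | rfl <;> simp
  · obtain rfl : a₁ = a₂ := h1.trans h2.symm
    refine Or.inr ⟨rfl, h1, ?_, by linarith, by linarith, ?_⟩
    · rintro ⟨rfl, rfl⟩
      exact h₁₂' ⟨sub_self _, sub_self _, sub_self _⟩
    · simp only [comp_centerVec_dotProduct, map_sub] at h5 ⊢
      linear_combination h5

end Collinear

section Germs

open Polynomial Matrix Filter

/-- The germ of a real polynomial function along an ultrafilter. -/
def polynomialGerm (U : Ultrafilter ℝ) : ℝ[X] →+* Germ (U : Filter ℝ) ℝ :=
  (Germ.coeRingHom (U : Filter ℝ)).comp (RingHom.pi fun t => evalRingHom t)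

theorem polynomialGerm_injective {U : Ultrafilter ℝ} (hU : (U : Filter ℝ) ≤ cofinite) :
    Function.Injective (polynomialGerm U) := by
  rw [injective_iff_map_eq_zero]
  intro P hP
  by_contra h
  have h1 : ∀ᶠ t in (U : Filter ℝ), P.eval t = 0 := Germ.coe_eq.1 hP
  have h2 : ∀ᶠ t in (U : Filter ℝ), P.eval t ≠ 0 :=
    hU ((finite_setOfPred_isRoot h).subset (by intro t ht; simpa using ht))
  obtain ⟨t, h3, h4⟩ := (h1.and h2).exists
  exact h4 h3

theorem collinear_of_infinite_tangents {T : Set ℝ} (hT : T.Infinite)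
    {a₁ b₁ c₁ a₂ b₂ c₂ a₃ b₃ c₃ r₁ r₂ r₃ : ℝ} {v : ℝ → Fin 3 → ℝ}
    (hr₁ : 0 < r₁) (hr₂ : 0 < r₂) (hr₃ : 0 < r₃)
    (h₁₂ : ¬ (a₁ = a₂ ∧ b₁ = b₂ ∧ c₁ = c₂ ∧ r₁ = r₂))
    (h₁₃ : ¬ (a₁ = a₃ ∧ b₁ = b₃ ∧ c₁ = c₃ ∧ r₁ = r₃))
    (h₂₃ : ¬ (a₂ = a₃ ∧ b₂ = b₃ ∧ c₂ = c₃ ∧ r₂ = r₃))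
    (hv : ∀ t ∈ T, v t ⬝ᵥ v t = 1) (hv₀ : ∀ t ∈ T, v t 0 ^ 2 ≠ 1)
    (hs₁ : ∀ t ∈ T, (![a₁ - t, b₁, c₁] ⬝ᵥ v t) ^ 2 = (t - a₁) ^ 2 + (b₁ ^ 2 + c₁ ^ 2 - r₁ ^ 2))
    (hs₂ : ∀ t ∈ T, (![a₂ - t, b₂, c₂] ⬝ᵥ v t) ^ 2 = (t - a₂) ^ 2 + (b₂ ^ 2 + c₂ ^ 2 - r₂ ^ 2))
    (hs₃ : ∀ t ∈ T, (![a₃ - t, b₃, c₃] ⬝ᵥ v t) ^ 2 = (t - a₃) ^ 2 + (b₃ ^ 2 + c₃ ^ 2 - r₃ ^ 2)) :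
    (∃ l : ℝ, a₃ - a₁ = l * (a₂ - a₁) ∧ b₃ - b₁ = l * (b₂ - b₁) ∧ c₃ - c₁ = l * (c₂ - c₁)) ∧
    ((b₁ ^ 2 + c₁ ^ 2 = r₁ ^ 2 ∧ b₂ ^ 2 + c₂ ^ 2 = r₂ ^ 2 ∧ b₃ ^ 2 + c₃ ^ 2 = r₃ ^ 2 ∧
        ¬ (b₁ = b₂ ∧ c₁ = c₂)) ∨
      (a₁ = a₂ ∧ a₁ = a₃ ∧ ¬ (b₁ = b₂ ∧ c₁ = c₂) ∧
        b₁ ^ 2 + c₁ ^ 2 - r₁ ^ 2 = b₂ ^ 2 + c₂ ^ 2 - r₂ ^ 2 ∧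
        b₁ ^ 2 + c₁ ^ 2 - r₁ ^ 2 = b₃ ^ 2 + c₃ ^ 2 - r₃ ^ 2 ∧
        ∃ t ∈ T, (b₁ - b₂) * v t 1 + (c₁ - c₂) * v t 2 = 0)) := by
  have hne : (cofinite ⊓ 𝓟 T).NeBot := cofinite_inf_principal_neBot_iff.2 hT
  let U : Ultrafilter ℝ := Ultrafilter.of (cofinite ⊓ 𝓟 T)
  have hU : (U : Filter ℝ) ≤ cofinite ⊓ 𝓟 T := Ultrafilter.of_le _
  have hUT : ∀ᶠ t in (U : Filter ℝ), t ∈ T := (hU.trans inf_le_right) (mem_principal_self T)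
  let V : Fin 3 → Germ (U : Filter ℝ) ℝ := fun i => ((fun t => v t i : ℝ → ℝ) : Germ _ ℝ)
  have hs {a b c r : ℝ} (h : ∀ t ∈ T, (![a - t, b, c] ⬝ᵥ v t) ^ 2 =
      (t - a) ^ 2 + (b ^ 2 + c ^ 2 - r ^ 2)) :
      ((polynomialGerm U ∘ centerVec a b c) ⬝ᵥ V) ^ 2 =
        polynomialGerm U (monicQuadratic a (b ^ 2 + c ^ 2 - r ^ 2)) := by
    rw [comp_centerVec_dotProduct]
    refine Germ.coe_eq.2 ?_
    filter_upwards [hUT] with t ht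
    have hev (P : ℝ[X]) : RingHom.pi (fun t : ℝ => evalRingHom t) P t = P.eval t := rfl
    simpa [dotProduct, Fin.sum_univ_three, hev] using h t ht
  have hV : V ⬝ᵥ V = 1 := by
    rw [dotProduct, Fin.sum_univ_three]
    refine Germ.coe_eq.2 ?_
    filter_upwards [hUT] with t ht
    simpa [dotProduct, Fin.sum_univ_three] using hv t ht
  have hV₀ : V 0 ^ 2 ≠ 1 := by
    intro h
    have h : ∀ᶠ t in (U : Filter ℝ), v t 0 ^ 2 = 1 := Germ.coe_eq.1 h
    obtain ⟨t, h1, h2⟩ := (hUT.and h).exists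
    exact hv₀ t h1 h2
  obtain ⟨hl, h | ⟨h1, h2, h3, h4, h5, h6⟩⟩ := collinear_of_generic_tangent
    (polynomialGerm_injective (hU.trans inf_le_left)) hV hV₀ hr₁ hr₂ hr₃ h₁₂ h₁₃ h₂₃
    (hs hs₁) (hs hs₂) (hs hs₃)
  · exact ⟨hl, Or.inl h⟩
  · refine ⟨hl, Or.inr ⟨h1, h2, h3, h4, h5, ?_⟩⟩
    have h : ∀ᶠ t in (U : Filter ℝ), (C (b₁ - b₂)).eval t * v t 1 +
      (C (c₁ - c₂)).eval t * v t 2 = 0 := Germ.coe_eq.1 h6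
    obtain ⟨t, ht, h⟩ := (hUT.and h).exists
    exact ⟨t, ht, by simpa only [eval_C] using h⟩

end Germs

section Lines

open scoped RealInnerProductSpace

theorem isLine_mk' (p : E3) {v : E3} (hv : v ≠ 0) : IsLine (AffineSubspace.mk' p (ℝ ∙ v)) := by
  rw [IsLine, AffineSubspace.direction_mk']
  exact finrank_span_singleton hv

theorem IsLine.exists_eq_mk' {L : AffineSubspace ℝ E3} (hL : IsLine L) {p : E3} (hp : p ∈ L) :
    ∃ v : E3, ‖v‖ = 1 ∧ L = AffineSubspace.mk' p (ℝ ∙ v) := by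
  obtain ⟨w, hw, hspan⟩ := finrank_eq_one_iff'.1 hL
  have hw' : (w : E3) ≠ 0 := fun h => hw (Subtype.ext h)
  have hn : ‖(w : E3)‖ ≠ 0 := norm_ne_zero_iff.2 hw'
  refine ⟨‖(w : E3)‖⁻¹ • (w : E3), norm_smul_inv_norm hw', ?_⟩
  rw [Submodule.span_singleton_smul_eq (IsUnit.mk0 _ (inv_ne_zero hn))]
  have : L.direction = ℝ ∙ (w : E3) := by
    apply le_antisymm
    · intro x hx
      obtain ⟨c, hc⟩ := hspan ⟨x, hx⟩
      exact Submodule.mem_span_singleton.2 ⟨c, congrArg Subtype.val hc⟩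
    · rw [Submodule.span_singleton_le_iff_mem]
      exact w.2
  rw [← this, AffineSubspace.mk'_eq hp]

theorem IsLine.nonempty {L : AffineSubspace ℝ E3} (hL : IsLine L) : (L : Set E3).Nonempty := by
  rw [AffineSubspace.nonempty_iff_ne_bot]
  rintro rfl
  rw [IsLine, AffineSubspace.direction_bot, finrank_bot] at hL
  exact zero_ne_one hL

theorem mem_mk'_span_singleton {p v x : E3} :
    x ∈ AffineSubspace.mk' p (ℝ ∙ v) ↔ ∃ s : ℝ, x = p + s • v := by
  rw [AffineSubspace.mem_mk', Submodule.mem_span_singleton, vsub_eq_sub]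
  exact exists_congr fun s => ⟨fun h => by rw [h]; abel, fun h => by rw [h]; abel⟩

theorem exists_smul_eq_of_mk'_eq {p q v w : E3}
    (h : AffineSubspace.mk' p (ℝ ∙ v) = AffineSubspace.mk' q (ℝ ∙ w)) : ∃ s : ℝ, s • v = w := by
  have h := congrArg AffineSubspace.direction h
  rw [AffineSubspace.direction_mk', AffineSubspace.direction_mk'] at h
  exact Submodule.mem_span_singleton.1 (h ▸ Submodule.mem_span_singleton_self w)

theorem tangent_mk'_iff {c p v : E3} {r : ℝ} (hv : v ≠ 0) (hr : 0 ≤ r) :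
    Tangent c r (AffineSubspace.mk' p (ℝ ∙ v)) ↔
      ⟪c - p, v⟫ ^ 2 = (‖c - p‖ ^ 2 - r ^ 2) * ‖v‖ ^ 2 := by
  have hn : ‖v‖ ^ 2 ≠ 0 := pow_ne_zero 2 (norm_ne_zero_iff.2 hv)
  have hdist (s : ℝ) : dist c (p + s • v) ^ 2 =
      ‖c - p‖ ^ 2 - ⟪c - p, v⟫ ^ 2 / ‖v‖ ^ 2 + (s - ⟪c - p, v⟫ / ‖v‖ ^ 2) ^ 2 * ‖v‖ ^ 2 := by
    rw [dist_eq_norm, ← sub_sub, norm_sub_sq_real, inner_smul_right, norm_smul, mul_pow,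
      Real.norm_eq_abs, sq_abs]
    field_simp
    ring
  have hmem (s : ℝ) : p + s • v ∈ AffineSubspace.mk' p (ℝ ∙ v) :=
    mem_mk'_span_singleton.2 ⟨s, rfl⟩
  have key : Metric.infDist c (AffineSubspace.mk' p (ℝ ∙ v) : Set E3) =
      dist c (p + (⟪c - p, v⟫ / ‖v‖ ^ 2) • v) := by
    apply le_antisymm (Metric.infDist_le_dist_of_mem (hmem _))
    rw [Metric.le_infDist ⟨_, hmem 0⟩]
    intro y hy
    obtain ⟨s, rfl⟩ := mem_mk'_span_singleton.1 hy
    rw [← sq_le_sq₀ dist_nonneg dist_nonneg, hdist, hdist]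
    simp only [sub_self]
    nlinarith [mul_nonneg (sq_nonneg (s - ⟪c - p, v⟫ / ‖v‖ ^ 2)) (sq_nonneg ‖v‖)]
  rw [Tangent, key, ← sq_eq_sq₀ dist_nonneg hr, hdist, sub_self]
  field_simp
  constructor <;> intro h <;> linarith

theorem exists_orthonormalBasis_of_norm_eq_one {e : E3} (he : ‖e‖ = 1) :
    ∃ b : OrthonormalBasis (Fin 3) ℝ E3, b 0 = e := by
  obtain ⟨b, hb⟩ := Orthonormal.exists_orthonormalBasis_extension_of_card_eq
    (𝕜 := ℝ) (E := E3) (ι := Fin 3) (by simp) (v := fun _ => e) (s := {0}) (by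
      constructor
      · intro i; simpa using he
      · rintro ⟨i, rfl⟩ ⟨j, rfl⟩ h; exact (h rfl).elim)
  exact ⟨b, hb 0 rfl⟩

theorem OrthonormalBasis.inner_eq (b : OrthonormalBasis (Fin 3) ℝ E3) (x y : E3) :
    ⟪x, y⟫ = ⟪x, b 0⟫ * ⟪y, b 0⟫ + ⟪x, b 1⟫ * ⟪y, b 1⟫ + ⟪x, b 2⟫ * ⟪y, b 2⟫ := by
  rw [← b.sum_inner_mul_inner, Fin.sum_univ_three, real_inner_comm y, real_inner_comm y,
    real_inner_comm y]

theorem OrthonormalBasis.norm_sq_eq (b : OrthonormalBasis (Fin 3) ℝ E3) (x : E3) :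
    ‖x‖ ^ 2 = ⟪x, b 0⟫ ^ 2 + ⟪x, b 1⟫ ^ 2 + ⟪x, b 2⟫ ^ 2 := by
  rw [← real_inner_self_eq_norm_sq, b.inner_eq]
  ring

theorem OrthonormalBasis.eq_add (b : OrthonormalBasis (Fin 3) ℝ E3) (x : E3) :
    x = ⟪x, b 0⟫ • b 0 + ⟪x, b 1⟫ • b 1 + ⟪x, b 2⟫ • b 2 := by
  conv_lhs => rw [← b.sum_repr' x, Fin.sum_univ_three]
  simp only [real_inner_comm]

theorem OrthonormalBasis.ext_inner (b : OrthonormalBasis (Fin 3) ℝ E3) {x y : E3}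
    (h₀ : ⟪x, b 0⟫ = ⟪y, b 0⟫) (h₁ : ⟪x, b 1⟫ = ⟪y, b 1⟫) (h₂ : ⟪x, b 2⟫ = ⟪y, b 2⟫) : x = y := by
  rw [b.eq_add x, b.eq_add y, h₀, h₁, h₂]

end Lines

section Planes

open scoped RealInnerProductSpace

theorem isPlane_mk'_orthogonal (p : E3) {u : E3} (hu : u ≠ 0) :
    IsPlane (AffineSubspace.mk' p (ℝ ∙ u)ᗮ) := by
  have : Fact (Module.finrank ℝ E3 = 2 + 1) := ⟨by simp⟩
  rw [IsPlane, AffineSubspace.direction_mk']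
  exact Submodule.finrank_orthogonal_span_singleton hu

theorem mem_mk'_orthogonal {p u x : E3} :
    x ∈ AffineSubspace.mk' p (ℝ ∙ u)ᗮ ↔ ⟪u, x - p⟫ = 0 := by
  rw [AffineSubspace.mem_mk', Submodule.mem_orthogonal_singleton_iff_inner_right, vsub_eq_sub]

theorem dist_sq_of_mem_mk'_orthogonal {p u x : E3} (τ : ℝ)
    (hx : x ∈ AffineSubspace.mk' p (ℝ ∙ u)ᗮ) :
    dist x (p + τ • u) ^ 2 = ‖x - p‖ ^ 2 + τ ^ 2 * ‖u‖ ^ 2 := by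
  rw [mem_mk'_orthogonal] at hx
  rw [dist_eq_norm, ← sub_sub, norm_sub_sq_real, inner_smul_right, real_inner_comm, hx, norm_smul,
    mul_pow, Real.norm_eq_abs, sq_abs]
  ring

theorem sphere_inter_mk'_orthogonal {p u : E3} {τ r : ℝ} (hr : 0 ≤ r)
    (h : r ^ 2 = τ ^ 2 * ‖u‖ ^ 2) :
    Metric.sphere (p + τ • u) r ∩ (AffineSubspace.mk' p (ℝ ∙ u)ᗮ : Set E3) = {p} := by
  ext x
  rw [Set.mem_inter_iff, Metric.mem_sphere, SetLike.mem_coe, Set.mem_singleton_iff]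
  constructor
  · rintro ⟨h1, h2⟩
    have h3 := dist_sq_of_mem_mk'_orthogonal τ h2
    rw [h1, h] at h3
    exact sub_eq_zero.1 (norm_eq_zero.1 (sq_eq_zero_iff.1 (by linarith)))
  · rintro rfl
    have hx : x ∈ AffineSubspace.mk' x (ℝ ∙ u)ᗮ := AffineSubspace.self_mem_mk' _ _
    refine ⟨?_, hx⟩
    rw [← sq_eq_sq₀ dist_nonneg hr, dist_sq_of_mem_mk'_orthogonal τ hx, h]
    simp

theorem inner_eq_zero_of_sphere_inter_eq_singleton {c p : E3} {r : ℝ} {P : AffineSubspace ℝ E3}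
    (hp : p ∈ P) (h : Metric.sphere c r ∩ (P : Set E3) = {p}) {w : E3} (hw : w ∈ P.direction) :
    ⟪c - p, w⟫ = 0 := by
  have hps : dist p c = r := (h.symm ▸ Set.mem_singleton p : p ∈ Metric.sphere c r ∩ (P : Set E3)).1
  rcases eq_or_ne w 0 with rfl | hw0
  · exact inner_zero_right _
  have hn : ‖w‖ ^ 2 ≠ 0 := pow_ne_zero 2 (norm_ne_zero_iff.2 hw0)
  have hx : (2 * ⟪c - p, w⟫ / ‖w‖ ^ 2) • w + p ∈ Metric.sphere c r ∩ (P : Set E3) := by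
    refine ⟨?_, AffineSubspace.vadd_mem_of_mem_direction (P.direction.smul_mem _ hw) hp⟩
    rw [Metric.mem_sphere, ← hps, ← sq_eq_sq₀ dist_nonneg dist_nonneg, dist_eq_norm, dist_eq_norm,
      add_sub_assoc, norm_add_sq_real, inner_smul_left, norm_smul, mul_pow, Real.norm_eq_abs,
      sq_abs, real_inner_comm, ← neg_sub c p, inner_neg_right]
    simp only [conj_trivial]
    field_simp
    ring
  rw [h, Set.mem_singleton_iff, add_eq_right, smul_eq_zero, or_iff_left hw0] at hx
  rcases div_eq_zero_iff.1 hx with hx | hx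
  · linarith
  · exact (hn hx).elim

theorem IsPlane.exists_normal {P : AffineSubspace ℝ E3} (hP : IsPlane P) :
    ∃ u : E3, ‖u‖ = 1 ∧ P.direction = (ℝ ∙ u)ᗮ := by
  have h1 : Module.finrank ℝ (P.directionᗮ : Submodule ℝ E3) = 1 := by
    have := Submodule.finrank_add_finrank_orthogonal P.direction
    rw [hP] at this
    simp at this
    omega
  obtain ⟨v, hv, hL⟩ := IsLine.exists_eq_mk' (L := AffineSubspace.mk' 0 P.directionᗮ) (p := 0)
    (by rwa [IsLine, AffineSubspace.direction_mk']) (AffineSubspace.self_mem_mk' _ _)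
  refine ⟨v, hv, ?_⟩
  have := congrArg AffineSubspace.direction hL
  rw [AffineSubspace.direction_mk', AffineSubspace.direction_mk'] at this
  rw [← this, Submodule.orthogonal_orthogonal]

theorem exists_eq_add_smul_of_orthogonal {c p u : E3}
    (h : ∀ w ∈ (ℝ ∙ u)ᗮ, ⟪c - p, w⟫ = 0) : ∃ τ : ℝ, c = p + τ • u := by
  have : c - p ∈ (ℝ ∙ u)ᗮᗮ := (Submodule.mem_orthogonal' _ _).2 h
  rw [Submodule.orthogonal_orthogonal, Submodule.mem_span_singleton] at this
  obtain ⟨τ, hτ⟩ := this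
  exact ⟨τ, by rw [hτ]; abel⟩

end Planes

section Cones

open scoped RealInnerProductSpace

theorem exists_smul_eq_of_infinite {w w' : E3} {α β : ℝ} (hw : w ≠ 0)
    (h : {v : E3 | ‖v‖ = 1 ∧ ⟪w, v⟫ ^ 2 = α ∧ ⟪w', v⟫ ^ 2 = β}.Infinite) :
    ∃ a : ℝ, a • w = w' := by
  by_contra! hne
  apply h
  have hli : LinearIndependent ℝ ![w, w'] := (LinearIndependent.pair_iff' hw).2 hne
  have h1 : Module.finrank ℝ ((Submodule.span ℝ (Set.range ![w, w']))ᗮ : Submodule ℝ E3) = 1 := by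
    have := Submodule.finrank_add_finrank_orthogonal (Submodule.span ℝ (Set.range ![w, w']))
    rw [finrank_span_eq_card hli] at this
    simp at this
    omega
  obtain ⟨n, hn, hspan⟩ := finrank_eq_one_iff'.1 h1
  have hn' : ‖(n : E3)‖ ^ 2 ≠ 0 := pow_ne_zero 2 (norm_ne_zero_iff.2 fun h => hn (Subtype.ext h))
  refine Set.Finite.of_finite_fibers (fun v => (⟪w, v⟫, ⟪w', v⟫)) ?_ ?_
  · refine (((Set.finite_singleton (-√α)).insert (√α)).prod
      ((Set.finite_singleton (-√β)).insert (√β))).subset ?_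
    rintro _ ⟨v, ⟨-, h2, h3⟩, rfl⟩
    have (a b : ℝ) (h : a ^ 2 = b) : a = √b ∨ a = -√b := by
      rw [← h, Real.sqrt_sq_eq_abs]
      rcases abs_choice a with h | h <;> rw [h] <;> simp
    exact ⟨this _ _ h2, this _ _ h3⟩
  · rintro _ ⟨v₁, ⟨hv₁, -, -⟩, rfl⟩
    refine ((Set.finite_singleton (v₁ + (-2 * ⟪v₁, (n : E3)⟫ / ‖(n : E3)‖ ^ 2) • (n : E3))).insert
      v₁).subset ?_
    rintro v ⟨⟨hv, -, -⟩, hfib⟩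
    obtain ⟨h2, h3⟩ := Prod.mk.inj hfib
    have hmem : v - v₁ ∈ (Submodule.span ℝ (Set.range ![w, w']))ᗮ := by
      rw [← Submodule.span_singleton_le_iff_mem, Submodule.le_orthogonal_iff_le_orthogonal,
        Submodule.span_le]
      rintro _ ⟨i, rfl⟩
      rw [SetLike.mem_coe, Submodule.mem_orthogonal_singleton_iff_inner_left]
      fin_cases i
      · simpa [inner_sub_right, sub_eq_zero] using h2
      · simpa [inner_sub_right, sub_eq_zero] using h3
    obtain ⟨s, hs⟩ := hspan ⟨_, hmem⟩
    have hs : s • (n : E3) = v - v₁ := congrArg Subtype.val hs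
    have hvs : v = v₁ + s • (n : E3) := by rw [hs]; abel
    have hq : s * (2 * ⟪v₁, (n : E3)⟫ + s * ‖(n : E3)‖ ^ 2) = 0 := by
      have := norm_add_sq_real v₁ (s • (n : E3))
      rw [← hvs, hv, hv₁, inner_smul_right, norm_smul, mul_pow, Real.norm_eq_abs, sq_abs] at this
      linarith
    rcases mul_eq_zero.1 hq with rfl | hq
    · left; rw [hvs]; simp
    · right
      rw [Set.mem_singleton_iff, hvs]
      congr 2
      rw [eq_div_iff hn']
      linarith

theorem exists_cone_of_infinite {p c₁ c₂ c₃ : E3} {r₁ r₂ r₃ : ℝ}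
    (hr₁ : 0 < r₁) (hr₂ : 0 < r₂) (hr₃ : 0 < r₃)
    (h : {v : E3 | ‖v‖ = 1 ∧ ⟪c₁ - p, v⟫ ^ 2 = ‖c₁ - p‖ ^ 2 - r₁ ^ 2 ∧
      ⟪c₂ - p, v⟫ ^ 2 = ‖c₂ - p‖ ^ 2 - r₂ ^ 2 ∧
      ⟪c₃ - p, v⟫ ^ 2 = ‖c₃ - p‖ ^ 2 - r₃ ^ 2}.Infinite) :
    ∃ (u : E3) (k τ₁ τ₂ τ₃ : ℝ), ‖u‖ = 1 ∧ 0 < k ∧ k ≤ 1 ∧ c₁ = p + τ₁ • u ∧ c₂ = p + τ₂ • u ∧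
      c₃ = p + τ₃ • u ∧ r₁ = k * |τ₁| ∧ r₂ = k * |τ₂| ∧ r₃ = k * |τ₃| := by
  obtain ⟨v, -, h1, h2, h3⟩ := h.nonempty
  have hw : c₁ - p ≠ 0 := by
    intro hw
    rw [hw, inner_zero_left, norm_zero] at h1
    nlinarith
  obtain ⟨a₂, ha₂⟩ := exists_smul_eq_of_infinite hw (h.mono fun v hv => ⟨hv.1, hv.2.1, hv.2.2.1⟩)
  obtain ⟨a₃, ha₃⟩ := exists_smul_eq_of_infinite hw (h.mono fun v hv => ⟨hv.1, hv.2.1, hv.2.2.2⟩)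
  have hn : ‖c₁ - p‖ ≠ 0 := norm_ne_zero_iff.2 hw
  set u := ‖c₁ - p‖⁻¹ • (c₁ - p) with hu
  have hu1 : ‖u‖ = 1 := norm_smul_inv_norm hw
  have hc₁ : c₁ - p = ‖c₁ - p‖ • u := by rw [hu, smul_inv_smul₀ hn]
  have hc (c : E3) (a : ℝ) (h : a • (c₁ - p) = c - p) : c - p = (a * ‖c₁ - p‖) • u := by
    rw [mul_smul, ← hc₁, h]
  have hc₂ := hc _ _ ha₂
  have hc₃ := hc _ _ ha₃
  have key (c : E3) (r τ : ℝ) (hc : c - p = τ • u)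
      (h : ⟪c - p, v⟫ ^ 2 = ‖c - p‖ ^ 2 - r ^ 2) : r ^ 2 = (1 - ⟪u, v⟫ ^ 2) * τ ^ 2 := by
    rw [hc, inner_smul_left, norm_smul, hu1, mul_one, Real.norm_eq_abs, sq_abs] at h
    simp only [conj_trivial] at h
    linarith
  have hk : 0 < 1 - ⟪u, v⟫ ^ 2 := by
    have := key _ _ _ hc₁ h1
    by_contra! hle
    nlinarith [mul_nonneg (sub_nonneg.2 hle) (sq_nonneg ‖c₁ - p‖)]
  have key' (c : E3) (r τ : ℝ) (hr : 0 < r) (hc : c - p = τ • u)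
      (h : ⟪c - p, v⟫ ^ 2 = ‖c - p‖ ^ 2 - r ^ 2) : r = √(1 - ⟪u, v⟫ ^ 2) * |τ| := by
    rw [← sq_eq_sq₀ hr.le (by positivity), mul_pow, Real.sq_sqrt hk.le, sq_abs]
    exact key c r τ hc h
  refine ⟨u, √(1 - ⟪u, v⟫ ^ 2), _, _, _, hu1, Real.sqrt_pos.2 hk, ?_, ?_, ?_, ?_,
    key' _ _ _ hr₁ hc₁ h1, key' _ _ _ hr₂ hc₂ h2, key' _ _ _ hr₃ hc₃ h3⟩
  · rw [Real.sqrt_le_one]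
    linarith [sq_nonneg ⟪u, v⟫]
  · rw [← hc₁]; abel
  · rw [← hc₂]; abel
  · rw [← hc₃]; abel

/-- Through the apex of a cone there are infinitely many lines on the cone. -/
theorem exists_infinite_lines_of_cone {ℓ : AffineSubspace ℝ E3} {p u : E3} {k : ℝ} (hp : p ∈ ℓ)
    (hu : ‖u‖ = 1) (hk : 0 < k) (hk1 : k ≤ 1) :
    {L : AffineSubspace ℝ E3 | IsLine L ∧ Meets L ℓ ∧
      ∀ τ : ℝ, Tangent (p + τ • u) (k * |τ|) L}.Infinite := by
  obtain ⟨b, rfl⟩ := exists_orthonormalBasis_of_norm_eq_one hu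
  have hk2 : 0 ≤ 1 - k ^ 2 := by nlinarith
  have hα := Real.sq_sqrt hk2
  set α := √(1 - k ^ 2)
  let d : ℝ → E3 := fun x => α • b 0 + (k * x) • b 1 + (k * √(1 - x ^ 2)) • b 2
  have h00 (i : Fin 3) : ⟪b i, b i⟫ = 1 := by simp
  have h01 {i j : Fin 3} (h : i ≠ j) : ⟪b i, b j⟫ = 0 := b.inner_eq_zero h
  have hd0 (x : ℝ) : ⟪d x, b 0⟫ = α := by
    simp [d, inner_add_left, inner_smul_left, h01]
  have hd1 (x : ℝ) : ⟪d x, b 1⟫ = k * x := by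
    simp [d, inner_add_left, inner_smul_left, h01]
  have hd2 (x : ℝ) : ⟪d x, b 2⟫ = k * √(1 - x ^ 2) := by
    simp [d, inner_add_left, inner_smul_left, h01]
  have hpos {x : ℝ} (hx : x ∈ Set.Ioo (0 : ℝ) 1) : 0 < 1 - x ^ 2 := by nlinarith [hx.1, hx.2]
  have hd {x : ℝ} (hx : x ∈ Set.Ioo (0 : ℝ) 1) : ‖d x‖ ^ 2 = 1 := by
    rw [b.norm_sq_eq, hd0, hd1, hd2, mul_pow, mul_pow, Real.sq_sqrt (hpos hx).le, hα]
    ring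
  have hne {x : ℝ} (hx : x ∈ Set.Ioo (0 : ℝ) 1) : d x ≠ 0 := by
    intro h
    have := hd hx
    rw [h, norm_zero] at this
    norm_num at this
  refine Set.infinite_of_injOn_mapsTo (s := Set.Ioo (0 : ℝ) 1)
    (f := fun x => AffineSubspace.mk' p (ℝ ∙ d x)) ?_ ?_ (Set.Ioo_infinite one_pos)
  · intro x hx y hy hxy
    obtain ⟨s, hs⟩ := exists_smul_eq_of_mk'_eq hxy
    have e1 : s * x = y := by
      have := congrArg (fun z => ⟪z, b 1⟫) hs
      simp only [inner_smul_left, hd1, conj_trivial] at this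
      exact mul_left_cancel₀ hk.ne' (by linarith)
    have e3 : s ^ 2 = 1 := by
      have := congrArg (fun z => ‖z‖ ^ 2) hs
      simpa only [norm_smul, mul_pow, Real.norm_eq_abs, sq_abs, hd hx, hd hy, mul_one] using this
    have hs0 : 0 < s := by
      by_contra! hle
      nlinarith [hx.1, hy.1]
    obtain rfl : s = 1 := by nlinarith
    rw [← e1, one_mul]
  · intro x hx
    refine ⟨isLine_mk' p (hne hx), ⟨p, AffineSubspace.self_mem_mk' _ _, hp⟩, fun τ => ?_⟩
    rw [tangent_mk'_iff (hne hx) (by positivity), add_sub_cancel_left, inner_smul_left,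
      real_inner_comm, hd0, hd hx, norm_smul, hu, mul_pow, mul_pow, mul_pow, sq_abs, hα,
      Real.norm_eq_abs, sq_abs]
    simp only [conj_trivial]
    ring

end Cones

section Configurations

variable (ℓ : AffineSubspace ℝ E3) (c₁ c₂ c₃ : E3) (r₁ r₂ r₃ : ℝ)

/-- The lines that meet `ℓ` and touch three given spheres. -/
def commonTangents : Set (AffineSubspace ℝ E3) :=
  {L | IsLine L ∧ Meets L ℓ ∧ Tangent c₁ r₁ L ∧ Tangent c₂ r₂ L ∧ Tangent c₃ r₃ L}

/-- The spheres touch a plane at the same point, and `ℓ` passes through this point or lies in this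
plane. -/
def TouchPlaneAtPoint : Prop :=
  ∃ (p : E3) (P : AffineSubspace ℝ E3), IsPlane P ∧ p ∈ P ∧
    Metric.sphere c₁ r₁ ∩ (P : Set E3) = {p} ∧
    Metric.sphere c₂ r₂ ∩ (P : Set E3) = {p} ∧
    Metric.sphere c₃ r₃ ∩ (P : Set E3) = {p} ∧
    (p ∈ ℓ ∨ (ℓ : Set E3) ⊆ (P : Set E3))

/-- The spheres are inscribed in a cone with apex on `ℓ`. -/
def InscribedInCone : Prop :=
  ∃ (p : E3) (v : E3) (k t₁ t₂ t₃ : ℝ), p ∈ ℓ ∧ ‖v‖ = 1 ∧ k ∈ Set.Ioo (0:ℝ) 1 ∧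
    t₁ ≠ 0 ∧ t₂ ≠ 0 ∧ t₃ ≠ 0 ∧
    c₁ = p + t₁ • v ∧ c₂ = p + t₂ • v ∧ c₃ = p + t₃ • v ∧
    r₁ = k * |t₁| ∧ r₂ = k * |t₂| ∧ r₃ = k * |t₃|

/-- The spheres meet in a common circle whose plane contains `ℓ`. -/
def ShareCircle : Prop :=
  ∃ (P : AffineSubspace ℝ E3) (o : E3) (ρ : ℝ), IsPlane P ∧
    (ℓ : Set E3) ⊆ (P : Set E3) ∧ o ∈ P ∧ 0 < ρ ∧
    (P : Set E3) ∩ Metric.sphere o ρ ⊆ Metric.sphere c₁ r₁ ∧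
    (P : Set E3) ∩ Metric.sphere o ρ ⊆ Metric.sphere c₂ r₂ ∧
    (P : Set E3) ∩ Metric.sphere o ρ ⊆ Metric.sphere c₃ r₃

/-- The centres lie on a line not parallel to `ℓ`, and `ℓ` touches the spheres. -/
def CollinearTouching : Prop :=
  ∃ m : AffineSubspace ℝ E3, IsLine m ∧ c₁ ∈ m ∧ c₂ ∈ m ∧ c₃ ∈ m ∧
    m.direction ≠ ℓ.direction ∧
    Metric.infDist c₁ (ℓ : Set E3) = r₁ ∧ Metric.infDist c₂ (ℓ : Set E3) = r₂ ∧
    Metric.infDist c₃ (ℓ : Set E3) = r₃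

end Configurations

section Backward

open scoped RealInnerProductSpace

variable {ℓ : AffineSubspace ℝ E3} {c₁ c₂ c₃ : E3} {r₁ r₂ r₃ : ℝ}

theorem infinite_commonTangents_of_cone {p u : E3} {k τ₁ τ₂ τ₃ : ℝ} (hp : p ∈ ℓ)
    (hu : ‖u‖ = 1) (hk : 0 < k) (hk1 : k ≤ 1) (hc₁ : c₁ = p + τ₁ • u) (hc₂ : c₂ = p + τ₂ • u)
    (hc₃ : c₃ = p + τ₃ • u) (hr₁ : r₁ = k * |τ₁|) (hr₂ : r₂ = k * |τ₂|) (hr₃ : r₃ = k * |τ₃|) :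
    (commonTangents ℓ c₁ c₂ c₃ r₁ r₂ r₃).Infinite := by
  subst hc₁ hc₂ hc₃ hr₁ hr₂ hr₃
  refine (exists_infinite_lines_of_cone hp hu hk hk1).mono ?_
  rintro L ⟨h1, h2, h3⟩
  exact ⟨h1, h2, h3 _, h3 _, h3 _⟩

theorem InscribedInCone.infinite (h : InscribedInCone ℓ c₁ c₂ c₃ r₁ r₂ r₃) :
    (commonTangents ℓ c₁ c₂ c₃ r₁ r₂ r₃).Infinite := by
  obtain ⟨p, v, k, t₁, t₂, t₃, hp, hv, hk, -, -, -, h1, h2, h3, h4, h5, h6⟩ := h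
  exact infinite_commonTangents_of_cone hp hv hk.1 hk.2.le h1 h2 h3 h4 h5 h6

theorem TouchPlaneAtPoint.infinite (hℓ : IsLine ℓ)
    (h : TouchPlaneAtPoint ℓ c₁ c₂ c₃ r₁ r₂ r₃) :
    (commonTangents ℓ c₁ c₂ c₃ r₁ r₂ r₃).Infinite := by
  obtain ⟨p, P, hP, hpP, h1, h2, h3, hor⟩ := h
  have hr {c : E3} {r : ℝ} (h : Metric.sphere c r ∩ (P : Set E3) = {p}) : r = ‖c - p‖ := by
    have : p ∈ Metric.sphere c r ∩ (P : Set E3) := h.symm ▸ Set.mem_singleton p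
    rw [← this.1, dist_comm, dist_eq_norm]
  by_cases hpℓ : p ∈ ℓ
  · obtain ⟨u, hu, hdir⟩ := hP.exists_normal
    have hc {c : E3} {r : ℝ} (h : Metric.sphere c r ∩ (P : Set E3) = {p}) :
        ∃ τ : ℝ, c = p + τ • u ∧ r = 1 * |τ| := by
      obtain ⟨τ, hτ⟩ := exists_eq_add_smul_of_orthogonal (c := c) (p := p) (u := u) fun w hw =>
        inner_eq_zero_of_sphere_inter_eq_singleton hpP h (hdir ▸ hw)
      refine ⟨τ, hτ, ?_⟩
      rw [hr h, hτ, add_sub_cancel_left, norm_smul, hu, mul_one, one_mul, Real.norm_eq_abs]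
    obtain ⟨τ₁, hc₁, hr₁⟩ := hc h1
    obtain ⟨τ₂, hc₂, hr₂⟩ := hc h2
    obtain ⟨τ₃, hc₃, hr₃⟩ := hc h3
    exact infinite_commonTangents_of_cone hpℓ hu one_pos le_rfl hc₁ hc₂ hc₃ hr₁ hr₂ hr₃
  · have hℓP := hor.resolve_left hpℓ
    obtain ⟨p₀, hp₀⟩ := hℓ.nonempty
    obtain ⟨e, he, rfl⟩ := hℓ.exists_eq_mk' hp₀
    have he0 : e ≠ 0 := norm_ne_zero_iff.1 (he.symm ▸ one_ne_zero)
    have hmem (t : ℝ) : p₀ + t • e ∈ AffineSubspace.mk' p₀ (ℝ ∙ e) :=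
      mem_mk'_span_singleton.2 ⟨t, rfl⟩
    have hne (t : ℝ) : p₀ + t • e - p ≠ 0 := by
      intro h
      rw [sub_eq_zero] at h
      exact hpℓ (h ▸ hmem t)
    have hdir (t : ℝ) : p₀ + t • e - p ∈ P.direction :=
      AffineSubspace.vsub_mem_direction (hℓP (hmem t)) hpP
    refine Set.infinite_of_injective_forall_mem
      (f := fun t : ℝ => AffineSubspace.mk' p (ℝ ∙ (p₀ + t • e - p))) ?_ fun t => ?_
    · intro t t' htt
      obtain ⟨s, hs⟩ := exists_smul_eq_of_mk'_eq htt
      by_cases hs1 : s = 1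
      · subst hs1
        rw [one_smul, sub_left_inj, add_right_inj] at hs
        exact smul_left_injective ℝ he0 hs
      · exfalso
        apply hpℓ
        rw [mem_mk'_span_singleton]
        have hs1' : 1 - s ≠ 0 := sub_ne_zero.2 (Ne.symm hs1)
        refine ⟨(t' - s * t) / (1 - s), ?_⟩
        rw [← sub_eq_zero, ← smul_eq_zero_iff_right hs1', smul_sub, smul_add, smul_smul,
          mul_div_cancel₀ _ hs1']
        rw [← sub_eq_zero] at hs
        rw [← hs]
        module
    · have ht {c : E3} {r : ℝ} (h : Metric.sphere c r ∩ (P : Set E3) = {p}) :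
          Tangent c r (AffineSubspace.mk' p (ℝ ∙ (p₀ + t • e - p))) := by
        rw [hr h, tangent_mk'_iff (hne t) (norm_nonneg _),
          inner_eq_zero_of_sphere_inter_eq_singleton hpP h (hdir t)]
        ring
      refine ⟨isLine_mk' p (hne t), ⟨p₀ + t • e, ?_, hmem t⟩, ht h1, ht h2, ht h3⟩
      exact mem_mk'_span_singleton.2 ⟨1, by rw [one_smul]; abel⟩

theorem exists_orthonormalBasis_of_orthonormal_pair {e u : E3} (he : ‖e‖ = 1) (hu : ‖u‖ = 1)
    (heu : ⟪e, u⟫ = 0) : ∃ b : OrthonormalBasis (Fin 3) ℝ E3, b 0 = e ∧ b 1 = u := by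
  obtain ⟨b, hb⟩ := Orthonormal.exists_orthonormalBasis_extension_of_card_eq
    (𝕜 := ℝ) (E := E3) (ι := Fin 3) (by simp) (v := ![e, u, 0]) (s := {0, 1}) (by
      constructor
      · rintro ⟨i, rfl | rfl⟩
        · simpa using he
        · simpa using hu
      · rintro ⟨i, rfl | rfl⟩ ⟨j, rfl | rfl⟩ h
        · exact (h rfl).elim
        · simpa using heu
        · simpa [real_inner_comm] using heu
        · exact (h rfl).elim)
  exact ⟨b, hb 0 (by simp), hb 1 (by simp)⟩

theorem ShareCircle.infinite (hℓ : IsLine ℓ) (hr₁ : 0 < r₁) (hr₂ : 0 < r₂) (hr₃ : 0 < r₃)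
    (h : ShareCircle ℓ c₁ c₂ c₃ r₁ r₂ r₃) :
    (commonTangents ℓ c₁ c₂ c₃ r₁ r₂ r₃).Infinite := by
  obtain ⟨P, o, ρ, hP, hℓP, hoP, hρ, h1, h2, h3⟩ := h
  obtain ⟨u, hu, hdir⟩ := hP.exists_normal
  obtain ⟨p₀, hp₀⟩ := hℓ.nonempty
  obtain ⟨e, he, rfl⟩ := hℓ.exists_eq_mk' hp₀
  have he_dir : e ∈ P.direction := by
    have hm : p₀ + (1 : ℝ) • e ∈ AffineSubspace.mk' p₀ (ℝ ∙ e) :=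
      mem_mk'_span_singleton.2 ⟨1, rfl⟩
    simpa using AffineSubspace.vsub_mem_direction (hℓP hm) (hℓP hp₀)
  have hp_dir : p₀ - o ∈ P.direction := AffineSubspace.vsub_mem_direction (hℓP hp₀) hoP
  have horth {w : E3} (hw : w ∈ P.direction) : ⟪w, u⟫ = 0 := by
    rw [hdir, Submodule.mem_orthogonal_singleton_iff_inner_left] at hw
    exact hw
  have hcirc {w : E3} (hw : w ∈ P.direction) (hn : ‖w‖ = 1) :
      w + w ≠ 0 ∧ o + ρ • w ∈ (P : Set E3) ∩ Metric.sphere o ρ := by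
    refine ⟨?_, ?_, ?_⟩
    · intro h
      rw [← two_smul ℝ, smul_eq_zero, or_iff_right two_ne_zero] at h
      rw [h, norm_zero] at hn
      exact zero_ne_one hn
    · rw [add_comm]
      exact AffineSubspace.vadd_mem_of_mem_direction (P.direction.smul_mem _ hw) hoP
    · rw [Metric.mem_sphere, dist_eq_norm, add_sub_cancel_left, norm_smul, hn, mul_one,
        Real.norm_eq_abs, abs_of_pos hρ]
  have hc {c : E3} {r : ℝ} (h : (P : Set E3) ∩ Metric.sphere o ρ ⊆ Metric.sphere c r) :
      ∃ τ : ℝ, c = o + τ • u ∧ r ^ 2 = ρ ^ 2 + τ ^ 2 := by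
    have hd {w : E3} (hw : w ∈ P.direction) (hn : ‖w‖ = 1) :
        ρ ^ 2 - 2 * (ρ * ⟪c - o, w⟫) + ‖c - o‖ ^ 2 = r ^ 2 := by
      have h1 := h (hcirc hw hn).2
      rw [Metric.mem_sphere, dist_eq_norm, add_sub_right_comm, ← neg_sub c o, neg_add_eq_sub] at h1
      have h2 := norm_sub_sq_real (ρ • w) (c - o)
      rw [h1, norm_smul, inner_smul_left, hn, mul_one, Real.norm_eq_abs, sq_abs,
        real_inner_comm] at h2
      exact h2.symm
    have hunit {w : E3} (hw : w ∈ P.direction) (hn : ‖w‖ = 1) : ⟪c - o, w⟫ = 0 := by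
      have h1 := hd hw hn
      have h2 := hd (P.direction.neg_mem hw) ((norm_neg w).trans hn)
      rw [inner_neg_right] at h2
      have : ρ * ⟪c - o, w⟫ = 0 := by linarith
      exact (mul_eq_zero.1 this).resolve_left hρ.ne'
    obtain ⟨τ, hτ⟩ := exists_eq_add_smul_of_orthogonal (c := c) (p := o) (u := u) fun w hw => by
      rcases eq_or_ne w 0 with rfl | hw0
      · exact inner_zero_right _
      have := hunit (P.direction.smul_mem ‖w‖⁻¹ (hdir ▸ hw)) (norm_smul_inv_norm hw0)
      rw [inner_smul_right] at this
      exact (mul_eq_zero.1 this).resolve_left (inv_ne_zero (norm_ne_zero_iff.2 hw0))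
    refine ⟨τ, hτ, ?_⟩
    have h1 := hd he_dir he
    rw [hunit he_dir he, hτ, add_sub_cancel_left, norm_smul, hu, mul_one, Real.norm_eq_abs,
      sq_abs] at h1
    linarith
  obtain ⟨b, rfl, rfl⟩ := exists_orthonormalBasis_of_orthonormal_pair he hu (horth he_dir)
  have h01 {i j : Fin 3} (h : i ≠ j) : ⟪b i, b j⟫ = 0 := b.inner_eq_zero h
  let d : ℝ → E3 := fun x => -√(1 - x ^ 2) • b 0 + x • b 2
  let q : ℝ → E3 := fun x => o + ρ • (x • b 0 + √(1 - x ^ 2) • b 2)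
  have hd0 (x : ℝ) : ⟪d x, b 0⟫ = -√(1 - x ^ 2) := by
    simp [d, inner_add_left, inner_smul_left, inner_neg_left, h01]
  have hd1 (x : ℝ) : ⟪d x, b 1⟫ = 0 := by
    simp [d, inner_add_left, inner_smul_left, inner_neg_left, h01]
  have hd2 (x : ℝ) : ⟪d x, b 2⟫ = x := by
    simp [d, inner_add_left, inner_smul_left, inner_neg_left, h01]
  have hpos {x : ℝ} (hx : x ∈ Set.Ioo (0 : ℝ) 1) : 0 < 1 - x ^ 2 := by nlinarith [hx.1, hx.2]
  have hd {x : ℝ} (hx : x ∈ Set.Ioo (0 : ℝ) 1) : ‖d x‖ ^ 2 = 1 := by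
    rw [b.norm_sq_eq, hd0, hd1, hd2, neg_sq, Real.sq_sqrt (hpos hx).le]
    ring
  have hne {x : ℝ} (hx : x ∈ Set.Ioo (0 : ℝ) 1) : d x ≠ 0 := by
    intro h
    have := hd hx
    rw [h, norm_zero] at this
    norm_num at this
  have htan {c : E3} {r x : ℝ} (hr : 0 < r) (hx : x ∈ Set.Ioo (0 : ℝ) 1)
      (h : (P : Set E3) ∩ Metric.sphere o ρ ⊆ Metric.sphere c r) :
      Tangent c r (AffineSubspace.mk' (q x) (ℝ ∙ d x)) := by
    obtain ⟨τ, rfl, hrτ⟩ := hc h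
    have e0 : ⟪o + τ • b 1 - q x, b 0⟫ = -(ρ * x) := by
      simp [q, inner_add_left, inner_sub_left, inner_smul_left, h01]
    have e1 : ⟪o + τ • b 1 - q x, b 1⟫ = τ := by
      simp [q, inner_add_left, inner_sub_left, inner_smul_left, h01]
    have e2 : ⟪o + τ • b 1 - q x, b 2⟫ = -(ρ * √(1 - x ^ 2)) := by
      simp [q, inner_add_left, inner_sub_left, inner_smul_left, h01]
    rw [tangent_mk'_iff (hne hx) hr.le, b.inner_eq, b.norm_sq_eq (_ - _), e0, e1, e2, hd0, hd1, hd2,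
      hd hx, hrτ, neg_sq, neg_sq, mul_pow, mul_pow, Real.sq_sqrt (hpos hx).le]
    ring
  refine Set.infinite_of_injOn_mapsTo (s := Set.Ioo (0 : ℝ) 1)
    (f := fun x => AffineSubspace.mk' (q x) (ℝ ∙ d x)) ?_ ?_ (Set.Ioo_infinite one_pos)
  · intro x hx y hy hxy
    obtain ⟨s, hs⟩ := exists_smul_eq_of_mk'_eq hxy
    have e1 : s * x = y := by
      have := congrArg (fun z => ⟪z, b 2⟫) hs
      simpa only [inner_smul_left, hd2, conj_trivial] using this
    have e3 : s ^ 2 = 1 := by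
      have := congrArg (fun z => ‖z‖ ^ 2) hs
      simpa only [norm_smul, mul_pow, Real.norm_eq_abs, sq_abs, hd hx, hd hy, mul_one] using this
    have hs0 : 0 < s := by
      by_contra! hle
      nlinarith [hx.1, hy.1]
    obtain rfl : s = 1 := by nlinarith
    rw [← e1, one_mul]
  · intro x hx
    have hx0 : x ≠ 0 := hx.1.ne'
    refine ⟨isLine_mk' _ (hne hx), ?_, htan hr₁ hx h1, htan hr₂ hx h2, htan hr₃ hx h3⟩
    refine ⟨q x + ((⟪p₀ - o, b 2⟫ - ρ * √(1 - x ^ 2)) / x) • d x,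
      mem_mk'_span_singleton.2 ⟨_, rfl⟩, ?_⟩
    refine mem_mk'_span_singleton.2 ⟨ρ * x - (⟪p₀ - o, b 2⟫ - ρ * √(1 - x ^ 2)) / x *
      √(1 - x ^ 2) - ⟪p₀ - o, b 0⟫, ?_⟩
    have hp1 := horth hp_dir
    rw [← sub_eq_zero]
    rw [inner_sub_left] at hp1
    apply b.ext_inner <;> simp [q, d, inner_add_left, inner_sub_left, inner_smul_left,
      inner_neg_left, h01]
    · ring
    · linarith
    · field_simp
      ring

theorem CollinearTouching.infinite (hℓ : IsLine ℓ) (hr₁ : 0 < r₁) (hr₂ : 0 < r₂) (hr₃ : 0 < r₃)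
    (h : CollinearTouching ℓ c₁ c₂ c₃ r₁ r₂ r₃) :
    (commonTangents ℓ c₁ c₂ c₃ r₁ r₂ r₃).Infinite := by
  obtain ⟨m, hm, hm₁, hm₂, hm₃, hdir, h1, h2, h3⟩ := h
  by_cases hmeet : Meets m ℓ
  · obtain ⟨p, hpm, hpℓ⟩ := hmeet
    obtain ⟨u, hu, rfl⟩ := hm.exists_eq_mk' hpm
    obtain ⟨e, he, rfl⟩ := hℓ.exists_eq_mk' hpℓ
    have he0 : e ≠ 0 := norm_ne_zero_iff.1 (he.symm ▸ one_ne_zero)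
    obtain ⟨τ₁, rfl⟩ := mem_mk'_span_singleton.1 hm₁
    obtain ⟨τ₂, rfl⟩ := mem_mk'_span_singleton.1 hm₂
    obtain ⟨τ₃, rfl⟩ := mem_mk'_span_singleton.1 hm₃
    have key {r τ : ℝ} (hr : 0 < r)
        (h : Metric.infDist (p + τ • u) (AffineSubspace.mk' p (ℝ ∙ e) : Set E3) = r) :
        r ^ 2 = (1 - ⟪u, e⟫ ^ 2) * τ ^ 2 := by
      have := (tangent_mk'_iff he0 hr.le).1 h
      rw [add_sub_cancel_left, inner_smul_left, norm_smul, he, hu, mul_one, Real.norm_eq_abs,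
        sq_abs] at this
      simp only [conj_trivial] at this
      linarith
    have hk : 0 < 1 - ⟪u, e⟫ ^ 2 := by
      have := key hr₁ h1
      by_contra! hle
      nlinarith [mul_nonneg (sub_nonneg.2 hle) (sq_nonneg τ₁)]
    have key' {r τ : ℝ} (hr : 0 < r)
        (h : Metric.infDist (p + τ • u) (AffineSubspace.mk' p (ℝ ∙ e) : Set E3) = r) :
        r = √(1 - ⟪u, e⟫ ^ 2) * |τ| := by
      rw [← sq_eq_sq₀ hr.le (by positivity), mul_pow, Real.sq_sqrt hk.le, sq_abs]
      exact key hr h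
    refine infinite_commonTangents_of_cone hpℓ hu (Real.sqrt_pos.2 hk) ?_ rfl rfl rfl
      (key' hr₁ h1) (key' hr₂ h2) (key' hr₃ h3)
    rw [Real.sqrt_le_one]
    linarith [sq_nonneg ⟪u, e⟫]
  · obtain ⟨o, ho⟩ := hm.nonempty
    obtain ⟨u, hu, rfl⟩ := hm.exists_eq_mk' ho
    obtain ⟨p₀, hp₀⟩ := hℓ.nonempty
    obtain ⟨e, he, rfl⟩ := hℓ.exists_eq_mk' hp₀
    have he0 : e ≠ 0 := norm_ne_zero_iff.1 (he.symm ▸ one_ne_zero)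
    have hskew (s t : ℝ) : o + s • u ≠ p₀ + t • e := fun h =>
      hmeet ⟨o + s • u, mem_mk'_span_singleton.2 ⟨s, rfl⟩, mem_mk'_span_singleton.2 ⟨t, h⟩⟩
    let W : ℝ → Submodule ℝ E3 := fun t => Submodule.span ℝ {u, p₀ + t • e - o}
    let d : ℝ → E3 := fun t => (W t).reflection e
    have heW (t : ℝ) : e ∉ W t := by
      intro h
      obtain ⟨α, β, hαβ⟩ := Submodule.mem_span_pair.1 h
      by_cases hβ : β = 0
      · subst hβ
        rw [zero_smul, add_zero] at hαβ
        have hα : α ≠ 0 := by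
          rintro rfl
          exact he0 (by rw [← hαβ, zero_smul])
        apply hdir
        rw [AffineSubspace.direction_mk', AffineSubspace.direction_mk', ← hαβ,
          Submodule.span_singleton_smul_eq (IsUnit.mk0 _ hα)]
      · apply hskew (-(α / β)) (t - 1 / β)
        have := congrArg (fun z => β⁻¹ • z) hαβ
        simp only [smul_add, smul_smul, inv_mul_cancel₀ hβ, one_smul] at this
        rw [sub_smul, neg_smul, div_eq_inv_mul, div_eq_inv_mul, mul_one, ← this]
        abel
    have hinner {t : ℝ} {w : E3} (hw : w ∈ W t) : ⟪w, d t⟫ = ⟪w, e⟫ := by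
      conv_lhs => rw [← (W t).reflection_mem_subspace_eq_self hw]
      exact (W t).reflection.inner_map_map _ _
    have hnorm (t : ℝ) : ‖d t‖ = 1 := by rw [LinearIsometryEquiv.norm_map, he]
    have hd0 (t : ℝ) : d t ≠ 0 := norm_ne_zero_iff.1 ((hnorm t).symm ▸ one_ne_zero)
    have hde {t : ℝ} (ht : t ∈ Set.Ioi (-⟪p₀ - o, e⟫)) (s : ℝ) : s • d t ≠ e := by
      intro h
      have hs := congrArg norm h
      rw [norm_smul, hnorm, he, mul_one, Real.norm_eq_abs] at hs
      rcases (abs_eq zero_le_one).1 hs with rfl | rfl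
      · rw [one_smul] at h
        exact heW t (((W t).reflection_eq_self_iff e).1 h)
      · have hw : p₀ + t • e - o ∈ W t := Submodule.subset_span (by simp)
        have h1 := hinner hw
        rw [← h, neg_smul, one_smul, inner_neg_right] at h1
        have h2 : ⟪p₀ + t • e - o, e⟫ = 0 := by
          rw [← h, neg_smul, one_smul, inner_neg_right]
          linarith
        rw [add_sub_right_comm, inner_add_left, inner_smul_left, real_inner_self_eq_norm_sq, he,
          conj_trivial] at h2
        have := Set.mem_Ioi.1 ht
        linarith
    have htan {c : E3} {r : ℝ} (hr : 0 < r) (t : ℝ) (hc : c ∈ AffineSubspace.mk' o (ℝ ∙ u))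
        (h : Metric.infDist c (AffineSubspace.mk' p₀ (ℝ ∙ e) : Set E3) = r) :
        Tangent c r (AffineSubspace.mk' (p₀ + t • e) (ℝ ∙ d t)) := by
      obtain ⟨τ, rfl⟩ := mem_mk'_span_singleton.1 hc
      have hmk : AffineSubspace.mk' p₀ (ℝ ∙ e) = AffineSubspace.mk' (p₀ + t • e) (ℝ ∙ e) := by
        conv_rhs => rw [← AffineSubspace.direction_mk' p₀ (ℝ ∙ e)]
        exact (AffineSubspace.mk'_eq (mem_mk'_span_singleton.2 ⟨t, rfl⟩)).symm
      have h' : Tangent (o + τ • u) r (AffineSubspace.mk' (p₀ + t • e) (ℝ ∙ e)) := hmk ▸ h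
      rw [tangent_mk'_iff he0 hr.le] at h'
      have hw : o + τ • u - (p₀ + t • e) ∈ W t :=
        Submodule.mem_span_pair.2 ⟨τ, -1, by rw [neg_one_smul]; abel⟩
      rw [tangent_mk'_iff (hd0 t) hr.le, hinner hw, h', he, hnorm]
    refine Set.infinite_of_injOn_mapsTo (s := Set.Ioi (-⟪p₀ - o, e⟫))
      (f := fun t => AffineSubspace.mk' (p₀ + t • e) (ℝ ∙ d t)) ?_ ?_ (Set.Ioi_infinite _)
    · intro t ht t' _ htt
      by_contra hne
      have hmem : p₀ + t' • e ∈ AffineSubspace.mk' (p₀ + t • e) (ℝ ∙ d t) := by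
        refine (show AffineSubspace.mk' (p₀ + t • e) (ℝ ∙ d t) =
          AffineSubspace.mk' (p₀ + t' • e) (ℝ ∙ d t') from htt) ▸ ?_
        exact AffineSubspace.self_mem_mk' _ _
      obtain ⟨s, hs⟩ := mem_mk'_span_singleton.1 hmem
      have hs' : s • d t = (t' - t) • e := by
        rw [add_assoc, add_right_inj] at hs
        rw [sub_smul, hs, add_sub_cancel_left]
      apply hde ht ((t' - t)⁻¹ * s)
      rw [mul_smul, hs', inv_smul_smul₀ (sub_ne_zero.2 (Ne.symm hne))]
    · intro t ht
      exact ⟨isLine_mk' _ (hd0 t), ⟨p₀ + t • e, AffineSubspace.self_mem_mk' _ _,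
        mem_mk'_span_singleton.2 ⟨t, rfl⟩⟩, htan hr₁ t hm₁ h1, htan hr₂ t hm₂ h2, htan hr₃ t hm₃ h3⟩

end Backward

section Forward

open Matrix
open scoped RealInnerProductSpace

variable {ℓ : AffineSubspace ℝ E3} {c₁ c₂ c₃ : E3} {r₁ r₂ r₃ : ℝ}

theorem touchPlaneAtPoint_or_inscribedInCone {p u : E3} {k τ₁ τ₂ τ₃ : ℝ} (hp : p ∈ ℓ)
    (hr₁ : 0 < r₁) (hr₂ : 0 < r₂) (hr₃ : 0 < r₃)
    (hu : ‖u‖ = 1) (hk : 0 < k) (hk1 : k ≤ 1) (hc₁ : c₁ = p + τ₁ • u) (hc₂ : c₂ = p + τ₂ • u)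
    (hc₃ : c₃ = p + τ₃ • u) (hk₁ : r₁ = k * |τ₁|) (hk₂ : r₂ = k * |τ₂|) (hk₃ : r₃ = k * |τ₃|) :
    TouchPlaneAtPoint ℓ c₁ c₂ c₃ r₁ r₂ r₃ ∨ InscribedInCone ℓ c₁ c₂ c₃ r₁ r₂ r₃ := by
  rcases hk1.eq_or_lt with rfl | hk1
  · left
    have hs {r τ : ℝ} (hr : 0 < r) (h : r = 1 * |τ|) : r ^ 2 = τ ^ 2 * ‖u‖ ^ 2 := by
      rw [h, hu, one_mul, sq_abs, one_pow, mul_one]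
    subst hc₁ hc₂ hc₃
    exact ⟨p, _, isPlane_mk'_orthogonal p (norm_ne_zero_iff.1 (hu.symm ▸ one_ne_zero)),
      AffineSubspace.self_mem_mk' _ _, sphere_inter_mk'_orthogonal hr₁.le (hs hr₁ hk₁),
      sphere_inter_mk'_orthogonal hr₂.le (hs hr₂ hk₂),
      sphere_inter_mk'_orthogonal hr₃.le (hs hr₃ hk₃), Or.inl hp⟩
  · right
    have hτ {r τ : ℝ} (hr : 0 < r) (h : r = k * |τ|) : τ ≠ 0 := by
      rintro rfl
      rw [abs_zero, mul_zero] at h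
      exact hr.ne' h
    exact ⟨p, u, k, τ₁, τ₂, τ₃, hp, hu, ⟨hk, hk1⟩, hτ hr₁ hk₁, hτ hr₂ hk₂, hτ hr₃ hk₃,
      hc₁, hc₂, hc₃, hk₁, hk₂, hk₃⟩

theorem touchPlaneAtPoint_or_inscribedInCone_of_infinite {p : E3} (hp : p ∈ ℓ)
    (hr₁ : 0 < r₁) (hr₂ : 0 < r₂) (hr₃ : 0 < r₃)
    (h : {L ∈ commonTangents ℓ c₁ c₂ c₃ r₁ r₂ r₃ | p ∈ L}.Infinite) :
    TouchPlaneAtPoint ℓ c₁ c₂ c₃ r₁ r₂ r₃ ∨ InscribedInCone ℓ c₁ c₂ c₃ r₁ r₂ r₃ := by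
  obtain ⟨u, k, τ₁, τ₂, τ₃, hu, hk, hk1, h1, h2, h3, h4, h5, h6⟩ :=
    exists_cone_of_infinite (p := p) (c₁ := c₁) (c₂ := c₂) (c₃ := c₃) hr₁ hr₂ hr₃ (by
      refine Set.Infinite.of_image (fun v : E3 => AffineSubspace.mk' p (ℝ ∙ v)) (h.mono ?_)
      rintro L ⟨⟨hL, -, h1, h2, h3⟩, hpL⟩
      obtain ⟨v, hv, rfl⟩ := hL.exists_eq_mk' hpL
      have hv0 : v ≠ 0 := norm_ne_zero_iff.1 (hv.symm ▸ one_ne_zero)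
      rw [tangent_mk'_iff hv0 hr₁.le, hv, one_pow, mul_one] at h1
      rw [tangent_mk'_iff hv0 hr₂.le, hv, one_pow, mul_one] at h2
      rw [tangent_mk'_iff hv0 hr₃.le, hv, one_pow, mul_one] at h3
      exact ⟨v, ⟨hv, h1, h2, h3⟩, rfl⟩)
  exact touchPlaneAtPoint_or_inscribedInCone hp hr₁ hr₂ hr₃ hu hk hk1 h1 h2 h3 h4 h5 h6

theorem touchPlaneAtPoint_or_shareCircle {p₀ e u v o : E3} {t τ₁ τ₂ τ₃ δ : ℝ}
    (hr₁ : 0 < r₁) (hr₂ : 0 < r₂) (hr₃ : 0 < r₃) (hu : u ≠ 0) (hue : ⟪u, e⟫ = 0)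
    (huo : ⟪u, p₀ - o⟫ = 0) (huv : ⟪u, v⟫ = 0) (hv : ‖v‖ = 1)
    (hc₁ : c₁ = o + τ₁ • u) (hc₂ : c₂ = o + τ₂ • u) (hc₃ : c₃ = o + τ₃ • u)
    (hδ₁ : r₁ ^ 2 = τ₁ ^ 2 * ‖u‖ ^ 2 + δ) (hδ₂ : r₂ ^ 2 = τ₂ ^ 2 * ‖u‖ ^ 2 + δ)
    (hδ₃ : r₃ ^ 2 = τ₃ ^ 2 * ‖u‖ ^ 2 + δ)
    (hs : ⟪c₁ - (p₀ + t • e), v⟫ ^ 2 = ‖c₁ - (p₀ + t • e)‖ ^ 2 - r₁ ^ 2) :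
    TouchPlaneAtPoint (AffineSubspace.mk' p₀ (ℝ ∙ e)) c₁ c₂ c₃ r₁ r₂ r₃ ∨
      ShareCircle (AffineSubspace.mk' p₀ (ℝ ∙ e)) c₁ c₂ c₃ r₁ r₂ r₃ := by
  have hℓP : (AffineSubspace.mk' p₀ (ℝ ∙ e) : Set E3) ⊆ AffineSubspace.mk' o (ℝ ∙ u)ᗮ := by
    intro x hx
    obtain ⟨s, rfl⟩ := mem_mk'_span_singleton.1 hx
    refine mem_mk'_orthogonal.2 ?_
    rw [add_sub_right_comm, inner_add_right, inner_smul_right, hue, huo]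
    ring
  have hq : p₀ + t • e ∈ AffineSubspace.mk' o (ℝ ∙ u)ᗮ :=
    hℓP (mem_mk'_span_singleton.2 ⟨t, rfl⟩)
  have hδ : 0 ≤ δ := by
    have h1 := dist_sq_of_mem_mk'_orthogonal τ₁ hq
    rw [← hc₁, dist_comm, dist_eq_norm, ← neg_sub, norm_neg] at h1
    have h2 : ⟪c₁ - (p₀ + t • e), v⟫ = ⟪o - (p₀ + t • e), v⟫ := by
      rw [hc₁, add_sub_right_comm, inner_add_left, inner_smul_left, huv, mul_zero, add_zero]
    have h3 := real_inner_mul_inner_self_le (o - (p₀ + t • e)) v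
    rw [real_inner_self_eq_norm_sq, real_inner_self_eq_norm_sq, hv] at h3
    rw [norm_sub_rev o] at h3
    rw [h2] at hs
    rw [norm_sub_rev] at h1
    nlinarith
  rcases hδ.eq_or_lt with rfl | hδ
  · left
    rw [add_zero] at hδ₁ hδ₂ hδ₃
    subst hc₁ hc₂ hc₃
    exact ⟨o, _, isPlane_mk'_orthogonal o hu, AffineSubspace.self_mem_mk' _ _,
      sphere_inter_mk'_orthogonal hr₁.le hδ₁, sphere_inter_mk'_orthogonal hr₂.le hδ₂,
      sphere_inter_mk'_orthogonal hr₃.le hδ₃, Or.inr hℓP⟩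
  · right
    have hsub {c : E3} {r τ : ℝ} (hr : 0 < r) (hc : c = o + τ • u)
        (h : r ^ 2 = τ ^ 2 * ‖u‖ ^ 2 + δ) :
        (AffineSubspace.mk' o (ℝ ∙ u)ᗮ : Set E3) ∩ Metric.sphere o √δ ⊆ Metric.sphere c r := by
      rintro x ⟨hx, hxo⟩
      rw [Metric.mem_sphere, dist_eq_norm] at hxo
      rw [Metric.mem_sphere, ← sq_eq_sq₀ dist_nonneg hr.le, hc,
        dist_sq_of_mem_mk'_orthogonal τ hx, hxo, Real.sq_sqrt hδ.le, h, add_comm]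
    exact ⟨_, o, √δ, isPlane_mk'_orthogonal o hu, hℓP, AffineSubspace.self_mem_mk' _ _,
      Real.sqrt_pos.2 hδ, hsub hr₁ hc₁ hδ₁, hsub hr₂ hc₂ hδ₂, hsub hr₃ hc₃ hδ₃⟩

theorem infinite_setOf_exists_commonTangent {p₀ e : E3}
    (hinf : (commonTangents (AffineSubspace.mk' p₀ (ℝ ∙ e)) c₁ c₂ c₃ r₁ r₂ r₃).Infinite)
    (hfin : ∀ p ∈ AffineSubspace.mk' p₀ (ℝ ∙ e),
      {L ∈ commonTangents (AffineSubspace.mk' p₀ (ℝ ∙ e)) c₁ c₂ c₃ r₁ r₂ r₃ | p ∈ L}.Finite) :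
    {t : ℝ | ∃ L ∈ commonTangents (AffineSubspace.mk' p₀ (ℝ ∙ e)) c₁ c₂ c₃ r₁ r₂ r₃,
      L ≠ AffineSubspace.mk' p₀ (ℝ ∙ e) ∧ p₀ + t • e ∈ L}.Infinite := by
  intro hT
  apply hinf
  refine ((Set.finite_singleton (AffineSubspace.mk' p₀ (ℝ ∙ e))).union
    (hT.biUnion fun t _ => hfin _ (mem_mk'_span_singleton.2 ⟨t, rfl⟩))).subset ?_
  intro L hL
  by_cases hLℓ : L = AffineSubspace.mk' p₀ (ℝ ∙ e)
  · exact Or.inl hLℓ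
  · obtain ⟨x, hxL, hxℓ⟩ := hL.2.1
    obtain ⟨t, rfl⟩ := mem_mk'_span_singleton.1 hxℓ
    exact Or.inr (Set.mem_biUnion (x := t) ⟨L, hL, hLℓ, hxL⟩ ⟨hL, hxL⟩)

theorem exists_configuration_of_infinite (hℓ : IsLine ℓ)
    (hr₁ : 0 < r₁) (hr₂ : 0 < r₂) (hr₃ : 0 < r₃)
    (h12 : (c₁, r₁) ≠ (c₂, r₂)) (h13 : (c₁, r₁) ≠ (c₃, r₃)) (h23 : (c₂, r₂) ≠ (c₃, r₃))
    (hinf : (commonTangents ℓ c₁ c₂ c₃ r₁ r₂ r₃).Infinite) :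
    TouchPlaneAtPoint ℓ c₁ c₂ c₃ r₁ r₂ r₃ ∨ InscribedInCone ℓ c₁ c₂ c₃ r₁ r₂ r₃ ∨
      ShareCircle ℓ c₁ c₂ c₃ r₁ r₂ r₃ ∨ CollinearTouching ℓ c₁ c₂ c₃ r₁ r₂ r₃ := by
  by_cases hfin : ∃ p ∈ ℓ, {L ∈ commonTangents ℓ c₁ c₂ c₃ r₁ r₂ r₃ | p ∈ L}.Infinite
  · obtain ⟨p, hp, h⟩ := hfin
    rcases touchPlaneAtPoint_or_inscribedInCone_of_infinite hp hr₁ hr₂ hr₃ h with h | h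
    · exact Or.inl h
    · exact Or.inr (Or.inl h)
  push Not at hfin
  obtain ⟨p₀, hp₀⟩ := hℓ.nonempty
  obtain ⟨e, he, rfl⟩ := hℓ.exists_eq_mk' hp₀
  have hT := infinite_setOf_exists_commonTangent hinf hfin
  set T : Set ℝ := _
  change T.Infinite at hT
  have hex : ∀ t, ∃ v : E3, t ∈ T → ‖v‖ = 1 ∧ (∀ s : ℝ, s • v ≠ e) ∧
      ⟪c₁ - (p₀ + t • e), v⟫ ^ 2 = ‖c₁ - (p₀ + t • e)‖ ^ 2 - r₁ ^ 2 ∧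
      ⟪c₂ - (p₀ + t • e), v⟫ ^ 2 = ‖c₂ - (p₀ + t • e)‖ ^ 2 - r₂ ^ 2 ∧
      ⟪c₃ - (p₀ + t • e), v⟫ ^ 2 = ‖c₃ - (p₀ + t • e)‖ ^ 2 - r₃ ^ 2 := by
    intro t
    by_cases ht : t ∈ T
    · obtain ⟨L, ⟨hL, -, h1, h2, h3⟩, hne, htL⟩ := ht
      obtain ⟨v, hv, rfl⟩ := hL.exists_eq_mk' htL
      have hv0 : v ≠ 0 := norm_ne_zero_iff.1 (hv.symm ▸ one_ne_zero)
      rw [tangent_mk'_iff hv0 hr₁.le, hv, one_pow, mul_one] at h1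
      rw [tangent_mk'_iff hv0 hr₂.le, hv, one_pow, mul_one] at h2
      rw [tangent_mk'_iff hv0 hr₃.le, hv, one_pow, mul_one] at h3
      refine ⟨v, fun _ => ⟨hv, ?_, h1, h2, h3⟩⟩
      rintro s rfl
      have hs : s ≠ 0 := by
        rintro rfl
        rw [zero_smul, norm_zero] at he
        exact zero_ne_one he
      apply hne
      rw [← Submodule.span_singleton_smul_eq (IsUnit.mk0 _ hs) v]
      conv_rhs => rw [← AffineSubspace.mk'_eq (mem_mk'_span_singleton.2 ⟨t, rfl⟩ :
        p₀ + t • s • v ∈ AffineSubspace.mk' p₀ (ℝ ∙ (s • v))), AffineSubspace.direction_mk']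
    · exact ⟨0, fun h => absurd h ht⟩
  choose v hv using hex
  obtain ⟨b, rfl⟩ := exists_orthonormalBasis_of_norm_eq_one he
  have h10 : ⟪b 0, b 1⟫ = 0 := b.inner_eq_zero (by decide)
  have h20 : ⟪b 0, b 2⟫ = 0 := b.inner_eq_zero (by decide)
  have hcoord {c : E3} {r t : ℝ} {w : E3} (h : ⟪c - (p₀ + t • b 0), w⟫ ^ 2 =
      ‖c - (p₀ + t • b 0)‖ ^ 2 - r ^ 2) :
      (![⟪c - p₀, b 0⟫ - t, ⟪c - p₀, b 1⟫, ⟪c - p₀, b 2⟫] ⬝ᵥ ![⟪w, b 0⟫, ⟪w, b 1⟫, ⟪w, b 2⟫]) ^ 2 =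
        (t - ⟪c - p₀, b 0⟫) ^ 2 + (⟪c - p₀, b 1⟫ ^ 2 + ⟪c - p₀, b 2⟫ ^ 2 - r ^ 2) := by
    rw [← sub_sub, b.inner_eq, b.norm_sq_eq] at h
    simp only [inner_sub_left (c - p₀), inner_smul_left, h10, h20, real_inner_self_eq_norm_sq, he,
      conj_trivial, one_pow, mul_one, mul_zero, sub_zero] at h
    simp only [dotProduct, Fin.sum_univ_three, Matrix.cons_val]
    rw [h]
    ring
  have hdistinct {c c' : E3} {r r' : ℝ} (h : (c, r) ≠ (c', r')) :
      ¬ (⟪c - p₀, b 0⟫ = ⟪c' - p₀, b 0⟫ ∧ ⟪c - p₀, b 1⟫ = ⟪c' - p₀, b 1⟫ ∧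
        ⟪c - p₀, b 2⟫ = ⟪c' - p₀, b 2⟫ ∧ r = r') := by
    rintro ⟨h0, h1, h2, rfl⟩
    exact h (Prod.ext (sub_left_injective (b.ext_inner h0 h1 h2)) rfl)
  obtain ⟨⟨l, hl0, hl1, hl2⟩, halt⟩ := collinear_of_infinite_tangents hT
    (v := fun t => ![⟪v t, b 0⟫, ⟪v t, b 1⟫, ⟪v t, b 2⟫]) hr₁ hr₂ hr₃
    (hdistinct h12) (hdistinct h13) (hdistinct h23)
    (fun t ht => by
      have := b.norm_sq_eq (v t)
      rw [(hv t ht).1] at this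
      simp only [dotProduct, Fin.sum_univ_three, Matrix.cons_val]
      linarith)
    (fun t ht h0 => by
      have h := b.norm_sq_eq (v t)
      rw [(hv t ht).1] at h
      simp only [Matrix.cons_val] at h0
      apply (hv t ht).2.1 ⟪v t, b 0⟫
      have h1 : ⟪v t, b 1⟫ = 0 := by nlinarith [sq_nonneg ⟪v t, b 2⟫]
      have h2 : ⟪v t, b 2⟫ = 0 := by nlinarith [sq_nonneg ⟪v t, b 1⟫]
      apply b.ext_inner
      · rw [inner_smul_left, conj_trivial, ← sq, h0, real_inner_self_eq_norm_sq, he, one_pow]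
      · rw [inner_smul_left, h1, mul_zero, h10]
      · rw [inner_smul_left, h2, mul_zero, h20])
    (fun t ht => hcoord (hv t ht).2.2.1) (fun t ht => hcoord (hv t ht).2.2.2.1)
    (fun t ht => hcoord (hv t ht).2.2.2.2)
  have hc₂ : c₂ = c₁ + (1 : ℝ) • (c₂ - c₁) := by module
  have hsub (x y : E3) (i : Fin 3) : ⟪x - y, b i⟫ = ⟪x - p₀, b i⟫ - ⟪y - p₀, b i⟫ := by
    rw [← inner_sub_left, sub_sub_sub_cancel_right]
  have hc₃ : c₃ = c₁ + l • (c₂ - c₁) := by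
    rw [← sub_eq_iff_eq_add']
    apply b.ext_inner <;> rw [inner_smul_left, conj_trivial, hsub c₃ c₁, hsub c₂ c₁] <;> assumption
  have hu0 (hne : ¬ (⟪c₁ - p₀, b 1⟫ = ⟪c₂ - p₀, b 1⟫ ∧ ⟪c₁ - p₀, b 2⟫ = ⟪c₂ - p₀, b 2⟫)) :
      c₂ - c₁ ≠ 0 := by
    intro h
    rw [sub_eq_zero] at h
    exact hne ⟨by rw [h], by rw [h]⟩
  rcases halt with ⟨h1, h2, h3, hne⟩ | ⟨h12', h13', hne, h1, h2, t, ht, h3⟩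
  · refine Or.inr (Or.inr (Or.inr ⟨AffineSubspace.mk' c₁ (ℝ ∙ (c₂ - c₁)), isLine_mk' _ (hu0 hne),
      AffineSubspace.self_mem_mk' _ _, mem_mk'_span_singleton.2 ⟨1, hc₂⟩,
      mem_mk'_span_singleton.2 ⟨l, hc₃⟩, ?_, ?_⟩))
    · intro h
      rw [AffineSubspace.direction_mk', AffineSubspace.direction_mk'] at h
      obtain ⟨s, hs⟩ := Submodule.mem_span_singleton.1
        (h ▸ Submodule.mem_span_singleton_self (c₂ - c₁))
      have hs' : c₂ - p₀ = c₁ - p₀ + s • b 0 := by rw [hs]; abel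
      rw [hs', inner_add_left, inner_add_left, inner_smul_left, inner_smul_left, h10, h20] at hne
      simp at hne
    · have htan {c : E3} {r : ℝ} (hr : 0 < r)
          (h : ⟪c - p₀, b 1⟫ ^ 2 + ⟪c - p₀, b 2⟫ ^ 2 = r ^ 2) :
          Tangent c r (AffineSubspace.mk' p₀ (ℝ ∙ b 0)) := by
        rw [tangent_mk'_iff (norm_ne_zero_iff.1 (he.symm ▸ one_ne_zero)) hr.le, he, b.norm_sq_eq]
        linarith
      exact ⟨htan hr₁ h1, htan hr₂ h2, htan hr₃ h3⟩
  · have hu := hu0 hne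
    have hn : ‖c₂ - c₁‖ ^ 2 ≠ 0 := pow_ne_zero 2 (norm_ne_zero_iff.2 hu)
    have hue : ⟪c₂ - c₁, b 0⟫ = 0 := by
      rw [hsub, h12', sub_self]
    obtain ⟨σ, hσ⟩ : ∃ σ : ℝ, σ = ⟪c₂ - c₁, c₁ - p₀⟫ / ‖c₂ - c₁‖ ^ 2 := ⟨_, rfl⟩
    obtain ⟨u, hu_def⟩ : ∃ u, u = c₂ - c₁ := ⟨_, rfl⟩
    obtain ⟨o, ho⟩ : ∃ o, o = c₁ - σ • u := ⟨_, rfl⟩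
    have huv : ⟪u, v t⟫ = 0 := by
      simp only [Matrix.cons_val] at h3
      rw [hu_def, b.inner_eq, hue, hsub c₂ c₁, hsub c₂ c₁]
      linarith
    rw [← hu_def] at hc₂ hc₃ hu hue hσ hn
    have huo : ⟪u, p₀ - o⟫ = 0 := by
      have : p₀ - o = σ • u - (c₁ - p₀) := by rw [ho]; abel
      rw [this, inner_sub_right, inner_smul_right, real_inner_self_eq_norm_sq, hσ,
        div_mul_cancel₀ _ hn, sub_self]
    have hpo : p₀ ∈ AffineSubspace.mk' o (ℝ ∙ u)ᗮ := mem_mk'_orthogonal.2 huo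
    have hδ {c : E3} {r τ : ℝ} (hc : c = o + τ • u) (ha : ⟪c₁ - p₀, b 0⟫ = ⟪c - p₀, b 0⟫)
        (h : ⟪c₁ - p₀, b 1⟫ ^ 2 + ⟪c₁ - p₀, b 2⟫ ^ 2 - r₁ ^ 2 =
          ⟪c - p₀, b 1⟫ ^ 2 + ⟪c - p₀, b 2⟫ ^ 2 - r ^ 2) :
        r ^ 2 = τ ^ 2 * ‖u‖ ^ 2 + (‖p₀ - o‖ ^ 2 - (‖c₁ - p₀‖ ^ 2 - r₁ ^ 2)) := by
      have h1 := dist_sq_of_mem_mk'_orthogonal τ hpo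
      rw [← hc, dist_comm, dist_eq_norm, b.norm_sq_eq, ← ha] at h1
      rw [b.norm_sq_eq (c₁ - p₀)]
      linarith
    have hc₁' : c₁ = o + σ • u := by rw [ho]; abel
    have hc₂' : c₂ = o + (σ + 1) • u := by rw [hc₂, ho]; module
    have hc₃' : c₃ = o + (σ + l) • u := by rw [hc₃, ho]; module
    rcases touchPlaneAtPoint_or_shareCircle hr₁ hr₂ hr₃ hu hue huo huv (hv t ht).1 hc₁' hc₂' hc₃'
      (hδ hc₁' rfl rfl) (hδ hc₂' h12' h1) (hδ hc₃' h13' h2) (hv t ht).2.2.1 with h | h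
    · exact Or.inl h
    · exact Or.inr (Or.inr (Or.inl h))

end Forward

/-- Classification of configurations of one line and three pairwise distinct spheres
admitting infinitely many common tangent lines that also meet the fixed line. -/
theorem infinitely_many_tangents_iff
    (ℓ : AffineSubspace ℝ E3) (hℓ : IsLine ℓ)
    (c₁ c₂ c₃ : E3) (r₁ r₂ r₃ : ℝ)
    (hr₁ : 0 < r₁) (hr₂ : 0 < r₂) (hr₃ : 0 < r₃)
    (h12 : (c₁, r₁) ≠ (c₂, r₂)) (h13 : (c₁, r₁) ≠ (c₃, r₃)) (h23 : (c₂, r₂) ≠ (c₃, r₃)) :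
    {L : AffineSubspace ℝ E3 | IsLine L ∧ Meets L ℓ ∧
        Tangent c₁ r₁ L ∧ Tangent c₂ r₂ L ∧ Tangent c₃ r₃ L}.Infinite ↔
      ((∃ (p : E3) (P : AffineSubspace ℝ E3), IsPlane P ∧ p ∈ P ∧
          Metric.sphere c₁ r₁ ∩ (P : Set E3) = {p} ∧
          Metric.sphere c₂ r₂ ∩ (P : Set E3) = {p} ∧
          Metric.sphere c₃ r₃ ∩ (P : Set E3) = {p} ∧
          (p ∈ ℓ ∨ (ℓ : Set E3) ⊆ (P : Set E3))) ∨
        (∃ (p : E3) (v : E3) (k t₁ t₂ t₃ : ℝ), p ∈ ℓ ∧ ‖v‖ = 1 ∧ k ∈ Set.Ioo (0:ℝ) 1 ∧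
          t₁ ≠ 0 ∧ t₂ ≠ 0 ∧ t₃ ≠ 0 ∧
          c₁ = p + t₁ • v ∧ c₂ = p + t₂ • v ∧ c₃ = p + t₃ • v ∧
          r₁ = k * |t₁| ∧ r₂ = k * |t₂| ∧ r₃ = k * |t₃|) ∨
        (∃ (P : AffineSubspace ℝ E3) (o : E3) (ρ : ℝ), IsPlane P ∧
          (ℓ : Set E3) ⊆ (P : Set E3) ∧ o ∈ P ∧ 0 < ρ ∧
          (P : Set E3) ∩ Metric.sphere o ρ ⊆ Metric.sphere c₁ r₁ ∧
          (P : Set E3) ∩ Metric.sphere o ρ ⊆ Metric.sphere c₂ r₂ ∧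
          (P : Set E3) ∩ Metric.sphere o ρ ⊆ Metric.sphere c₃ r₃) ∨
        (∃ m : AffineSubspace ℝ E3, IsLine m ∧ c₁ ∈ m ∧ c₂ ∈ m ∧ c₃ ∈ m ∧
          m.direction ≠ ℓ.direction ∧
          Metric.infDist c₁ (ℓ : Set E3) = r₁ ∧ Metric.infDist c₂ (ℓ : Set E3) = r₂ ∧
          Metric.infDist c₃ (ℓ : Set E3) = r₃)) := by
  constructor
  · exact exists_configuration_of_infinite hℓ hr₁ hr₂ hr₃ h12 h13 h23
  · rintro (h | h | h | h)
    · exact TouchPlaneAtPoint.infinite hℓ h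
    · exact InscribedInCone.infinite h
    · exact ShareCircle.infinite hℓ hr₁ hr₂ hr₃ h
    · exact CollinearTouching.infinite hℓ hr₁ hr₂ hr₃ h
end
end

section
/- Let S = S(c,r) be a sphere in Euclidean 3-space with r > 0 and let ℓ be a line with Metric.infDist c ℓ > r (so ℓ lies outside the sphere). Then there are exactly two planes Π containing ℓ that are tangent to S, i.e., exactly two planes Π with ℓ ⊆ Π and S ∩ Π a singleton. -/
noncomputable section

open scoped RealInnerProductSpace

theorem sphere_inter_hyperplane_eq_singleton_iff {V : Type*} [NormedAddCommGroup V]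
    [InnerProductSpace ℝ V] (c p n : V) (hn : ‖n‖ = 1) {r : ℝ} (hr : 0 < r) :
    (∃ q : V, Metric.sphere c r ∩ (AffineSubspace.mk' p (ℝ ∙ n)ᗮ : Set V) = {q}) ↔
      ⟪n, c - p⟫ ^ 2 = r ^ 2 := by
  have hnn : ⟪n, n⟫ = 1 := by rw [real_inner_self_eq_norm_sq, hn, one_pow]
  have mem_iff (x : V) : x ∈ Metric.sphere c r ∩ (AffineSubspace.mk' p (ℝ ∙ n)ᗮ : Set V) ↔
      ‖x - c‖ ^ 2 = r ^ 2 ∧ ⟪n, x - p⟫ = 0 := by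
    rw [Set.mem_inter_iff, mem_sphere_iff_norm, SetLike.mem_coe, AffineSubspace.mem_mk',
      vsub_eq_sub, Submodule.mem_orthogonal_singleton_iff_inner_right,
      sq_eq_sq₀ (norm_nonneg _) hr.le]
  set a := ⟪n, c - p⟫ with ha
  set f := c - a • n with hf
  have hfn : ⟪n, f - p⟫ = 0 := by
    rw [hf, sub_right_comm, inner_sub_right, inner_smul_right, hnn, ← ha]; ring
  have hfc : ‖f - c‖ ^ 2 = a ^ 2 := by
    rw [hf, sub_sub_cancel_left, norm_neg, norm_smul, hn, mul_one, Real.norm_eq_abs, sq_abs]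
  have pyth (v : V) (hv : ⟪n, v⟫ = 0) : ‖f + v - c‖ ^ 2 = ‖v‖ ^ 2 + a ^ 2 := by
    have : f + v - c = v - a • n := by rw [hf]; abel
    rw [this, norm_sub_sq_real, inner_smul_right, real_inner_comm, hv, norm_smul, hn,
      mul_one, Real.norm_eq_abs, sq_abs]
    ring
  constructor
  · rintro ⟨q, hq⟩
    obtain ⟨hqc, hqn⟩ := (mem_iff q).1 (hq ▸ Set.mem_singleton q)
    have hv : ⟪n, q - f⟫ = 0 := by
      rw [← sub_sub_sub_cancel_right q f p, inner_sub_right, hqn, hfn, sub_zero]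
    have hv' : ⟪n, f - q⟫ = 0 := by rw [← neg_sub, inner_neg_right, hv, neg_zero]
    have hmem : f + (f - q) ∈ ({q} : Set V) := by
      rw [← hq, mem_iff]
      constructor
      · rw [pyth _ hv', norm_sub_rev, ← pyth _ hv, add_sub_cancel, hqc]
      · rw [add_sub_right_comm, inner_add_right, hfn, hv', add_zero]
    have hfq : f = q := by
      have h2 : (2 : ℝ) • (f - q) = 0 := by
        rw [two_smul, ← sub_eq_zero.2 (Set.mem_singleton_iff.1 hmem)]; abel
      exact sub_eq_zero.1 ((smul_eq_zero.1 h2).resolve_left two_ne_zero)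
    rw [← hfc, hfq, hqc]
  · intro h
    refine ⟨f, Set.eq_singleton_iff_unique_mem.2
      ⟨(mem_iff f).2 ⟨hfc.trans h, hfn⟩, fun q hq => ?_⟩⟩
    obtain ⟨hqc, hqn⟩ := (mem_iff q).1 hq
    have hv : ⟪n, q - f⟫ = 0 := by
      rw [← sub_sub_sub_cancel_right q f p, inner_sub_right, hqn, hfn, sub_zero]
    have h0 := pyth _ hv
    rw [add_sub_cancel, hqc, h, right_eq_add, sq_eq_zero_iff, norm_eq_zero, sub_eq_zero] at h0
    exact h0

theorem exists_unit_span_of_finrank_eq_one {V : Type*} [NormedAddCommGroup V]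
    [InnerProductSpace ℝ V] {K : Submodule ℝ V} (hK : Module.finrank ℝ K = 1) :
    ∃ u : V, ‖u‖ = 1 ∧ K = ℝ ∙ u := by
  obtain ⟨⟨v, hvK⟩, hv0, hv⟩ := finrank_eq_one_iff'.1 hK
  have hv0' : v ≠ 0 := fun h => hv0 (Subtype.ext h)
  refine ⟨‖v‖⁻¹ • v, norm_smul_inv_norm hv0', ?_⟩
  rw [Submodule.span_singleton_smul_eq (IsUnit.mk0 _ (inv_ne_zero (norm_ne_zero_iff.2 hv0')))]
  refine le_antisymm (fun x hx => ?_) ((Submodule.span_singleton_le_iff_mem _ _).2 hvK)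
  obtain ⟨t, ht⟩ := hv ⟨x, hx⟩
  exact Submodule.mem_span_singleton.2 ⟨t, congrArg Subtype.val ht⟩

theorem exists_unit_normal_of_isPlane {P : AffineSubspace ℝ E3} (hP : IsPlane P) :
    ∃ n : E3, ‖n‖ = 1 ∧ P.direction = (ℝ ∙ n)ᗮ := by
  have h1 : Module.finrank ℝ P.directionᗮ = 1 := by
    have h := P.direction.finrank_add_finrank_orthogonal
    rw [hP, finrank_euclideanSpace_fin] at h
    omega
  obtain ⟨n, hn, hspan⟩ := exists_unit_span_of_finrank_eq_one h1
  exact ⟨n, hn, by rw [← hspan, Submodule.orthogonal_orthogonal]⟩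

theorem isPlane_mk'_orthogonal_span_singleton (p : E3) {n : E3} (hn : n ≠ 0) :
    IsPlane (AffineSubspace.mk' p (ℝ ∙ n)ᗮ) := by
  have : Fact (Module.finrank ℝ E3 = 2 + 1) := ⟨finrank_euclideanSpace_fin⟩
  rw [IsPlane, AffineSubspace.direction_mk']
  exact Submodule.finrank_orthogonal_span_singleton hn

/-- A line at positive distance from `c` admits an orthonormal frame whose first vector
spans the line and whose second vector points from the line to `c`. -/
theorem exists_adapted_frame (c : E3) {ℓ : AffineSubspace ℝ E3} (hℓ : IsLine ℓ)
    (hd : 0 < Metric.infDist c (ℓ : Set E3)) :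
    ∃ p ∈ ℓ, ∃ b : OrthonormalBasis (Fin 3) ℝ E3,
      ℓ.direction = ℝ ∙ b 0 ∧ c - p = Metric.infDist c (ℓ : Set E3) • b 1 := by
  have hne : (ℓ : Set E3).Nonempty := by
    rw [Set.nonempty_iff_ne_empty]
    intro h
    rw [h, Metric.infDist_empty] at hd
    exact hd.false
  have : Nonempty ℓ := hne.to_subtype
  set d := Metric.infDist c (ℓ : Set E3) with hd_def
  set p : E3 := ↑(EuclideanGeometry.orthogonalProjection ℓ c)
  have hpd : ‖c - p‖ = d := by
    rw [hd_def, ← EuclideanGeometry.dist_orthogonalProjection_eq_infDist, dist_eq_norm,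
      norm_sub_rev]
  obtain ⟨u, hu, hspan⟩ := exists_unit_span_of_finrank_eq_one hℓ
  have huw : ⟪u, c - p⟫ = 0 := by
    have h := EuclideanGeometry.vsub_orthogonalProjection_mem_direction_orthogonal ℓ c
    exact (Submodule.mem_orthogonal _ _).1 h u (hspan ▸ Submodule.mem_span_singleton_self u)
  let v : Fin 3 → E3 := ![u, d⁻¹ • (c - p), 0]
  have hv : Orthonormal ℝ (({0, 1} : Set (Fin 3)).domRestrict v) := by
    have hw : ‖d⁻¹ • (c - p)‖ = 1 := by
      rw [norm_smul, hpd, norm_inv, Real.norm_of_nonneg hd.le, inv_mul_cancel₀ hd.ne']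
    have huw' : ⟪u, d⁻¹ • (c - p)⟫ = 0 := by rw [inner_smul_right, huw, mul_zero]
    constructor
    · rintro ⟨i, rfl | rfl⟩
      exacts [hu, hw]
    · rintro ⟨i, rfl | rfl⟩ ⟨j, rfl | rfl⟩ hij
      exacts [(hij rfl).elim, huw', (real_inner_comm _ _).trans huw', (hij rfl).elim]
  obtain ⟨b, hb⟩ := hv.exists_orthonormalBasis_extension_of_card_eq (by simp)
  refine ⟨p, EuclideanGeometry.orthogonalProjection_mem c, b, ?_, ?_⟩
  · rw [hb 0 (by simp)]; exact hspan
  · rw [hb 1 (by simp)]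
    exact (smul_inv_smul₀ hd.ne' _).symm

/-- Through a line lying outside a sphere there pass exactly two planes tangent to
the sphere. -/
theorem two_tangent_planes_through_line
    (c : E3) (r : ℝ) (hr : 0 < r)
    (ℓ : AffineSubspace ℝ E3) (hℓ : IsLine ℓ)
    (hout : r < Metric.infDist c (ℓ : Set E3)) :
    ∃ P₁ P₂ : AffineSubspace ℝ E3, P₁ ≠ P₂ ∧
      ∀ P : AffineSubspace ℝ E3,
        (IsPlane P ∧ (ℓ : Set E3) ⊆ (P : Set E3) ∧
          ∃ q : E3, Metric.sphere c r ∩ (P : Set E3) = {q}) ↔ (P = P₁ ∨ P = P₂) := by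
  obtain ⟨p, hp, b, hdir, hcp⟩ := exists_adapted_frame c hℓ (hr.trans hout)
  set d := Metric.infDist c (ℓ : Set E3)
  have hd : 0 < d := hr.trans hout
  set s := r / d
  have hs0 : 0 < s := div_pos hr hd
  have hs1 : s < 1 := (div_lt_one hd).2 hout
  have hsd : d * s = r := mul_div_cancel₀ r hd.ne'
  obtain ⟨k, hk0, hk⟩ : ∃ k : ℝ, 0 < k ∧ s ^ 2 + k ^ 2 = 1 := by
    have : 0 < 1 - s ^ 2 := by nlinarith
    exact ⟨√(1 - s ^ 2), Real.sqrt_pos.2 this, by rw [Real.sq_sqrt this.le]; ring⟩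
  have hbb (i j : Fin 3) : ⟪b i, b j⟫ = if i = j then 1 else 0 :=
    orthonormal_iff_ite.1 b.orthonormal i j
  have inner_frame (x y x' y' : ℝ) :
      ⟪x • b 1 + y • b 2, x' • b 1 + y' • b 2⟫ = x * x' + y * y' := by
    simp [inner_add_left, inner_add_right, inner_smul_left, inner_smul_right, hbb, mul_comm]
  have norm_frame (x y : ℝ) : ‖x • b 1 + y • b 2‖ ^ 2 = x ^ 2 + y ^ 2 := by
    rw [← real_inner_self_eq_norm_sq, inner_frame]; ring
  have inner_cp (x y : ℝ) : ⟪x • b 1 + y • b 2, c - p⟫ = d * x := by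
    have h := inner_frame x y d 0
    rw [zero_smul, add_zero, ← hcp] at h
    rw [h]; ring
  let plane (y : ℝ) : AffineSubspace ℝ E3 := AffineSubspace.mk' p (ℝ ∙ (s • b 1 + y • b 2))ᗮ
  have plane_tangent (y : ℝ) (hy : y ^ 2 = k ^ 2) :
      IsPlane (plane y) ∧ (ℓ : Set E3) ⊆ (plane y : Set E3) ∧
        ∃ q : E3, Metric.sphere c r ∩ (plane y : Set E3) = {q} := by
    have hn : ‖s • b 1 + y • b 2‖ = 1 := by
      rw [← sq_eq_sq₀ (norm_nonneg _) zero_le_one, norm_frame, hy, hk, one_pow]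
    refine ⟨isPlane_mk'_orthogonal_span_singleton p (norm_ne_zero_iff.1 (by simp [hn])),
      fun x hx => ?_, (sphere_inter_hyperplane_eq_singleton_iff c p _ hn hr).2 ?_⟩
    · have hxp : x -ᵥ p ∈ ℓ.direction := AffineSubspace.vsub_mem_direction hx hp
      obtain ⟨t, ht⟩ := Submodule.mem_span_singleton.1 (hdir ▸ hxp)
      rw [SetLike.mem_coe, AffineSubspace.mem_mk',
        Submodule.mem_orthogonal_singleton_iff_inner_right, ← ht]
      simp [inner_add_left, inner_smul_left, inner_smul_right, hbb]
    · rw [inner_cp, hsd]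
  refine ⟨plane k, plane (-k), fun h => ?_, fun P => ⟨?_, ?_⟩⟩
  · have hO := congrArg AffineSubspace.direction h
    simp only [plane, AffineSubspace.direction_mk'] at hO
    have hm : (-k) • b 1 + s • b 2 ∈ (ℝ ∙ (s • b 1 + k • b 2))ᗮ := by
      rw [Submodule.mem_orthogonal_singleton_iff_inner_right, inner_frame]; ring
    rw [hO, Submodule.mem_orthogonal_singleton_iff_inner_right, inner_frame] at hm
    nlinarith [mul_pos hs0 hk0]
  · rintro ⟨hP, hℓP, hq⟩
    obtain ⟨n, hn, hPn⟩ := exists_unit_normal_of_isPlane hP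
    have hPmk : P = AffineSubspace.mk' p (ℝ ∙ n)ᗮ := by
      rw [← hPn, AffineSubspace.mk'_eq (hℓP hp)]
    have hn0 : ⟪b 0, n⟫ = 0 := by
      have h : b 0 ∈ P.direction :=
        AffineSubspace.direction_le hℓP (hdir ▸ Submodule.mem_span_singleton_self _)
      rw [hPn, Submodule.mem_orthogonal_singleton_iff_inner_left] at h
      exact h
    obtain ⟨x, y, rfl⟩ : ∃ x y : ℝ, n = x • b 1 + y • b 2 := by
      refine ⟨⟪b 1, n⟫, ⟪b 2, n⟫, ?_⟩
      conv_lhs => rw [← b.sum_repr' n, Fin.sum_univ_three, hn0, zero_smul, zero_add]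
    rw [hPmk, sphere_inter_hyperplane_eq_singleton_iff c p _ hn hr, inner_cp, ← hsd,
      mul_pow, mul_pow, mul_right_inj' (pow_ne_zero 2 hd.ne')] at hq
    have hxy := norm_frame x y
    rw [hn, one_pow, hq, ← hk, add_right_inj, eq_comm,
      sq_eq_sq_iff_eq_or_eq_neg] at hxy
    have plane_neg (y : ℝ) :
        AffineSubspace.mk' p (ℝ ∙ (-s • b 1 + y • b 2))ᗮ = plane (-y) := by
      have h : -s • b 1 + y • b 2 = -(s • b 1 + -y • b 2) := by module
      rw [h, ← Set.neg_singleton, Submodule.span_neg]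
    rw [hPmk]
    rcases sq_eq_sq_iff_eq_or_eq_neg.1 hq with rfl | rfl <;> rcases hxy with rfl | rfl
    · exact Or.inl rfl
    · exact Or.inr rfl
    · exact Or.inr (plane_neg _)
    · exact Or.inl ((plane_neg _).trans (by rw [neg_neg]))
  · rintro (rfl | rfl)
    exacts [plane_tangent k rfl, plane_tangent (-k) (neg_sq k)]
end
end
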